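/- arXiv:1309.5979 — 3 statements merged into one kernel-verified Lean document; each statement's English description precedes it below -/
import Mathlib

section
/- Suppose μ ≥ 0 almost surely and P(μ > 0) > 0. Then there exists a finite threshold T ≥ 0 such that for every τ > T, the derivative of the soft-thresholding risk satisfies ∂r(τ; G)/∂τ > 0. -/
open MeasureTheory

/-- Standard Gaussian density `φ(z) = e^{-z²/2}/√(2π)`. -/
noncomputable def gaussPDF (z : ℝ) : ℝ := Real.exp (-z ^ 2 / 2) / Real.sqrt (2 * Real.pi)

/-- Soft-thresholding function `η(x; τ) = sign(x)·max(|x| − τ, 0)`. -/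
noncomputable def softThr (x τ : ℝ) : ℝ := Real.sign x * max (|x| - τ) 0

/-- Soft-thresholding risk `r(τ; G) = E_{μ∼G, Z∼N(0,1)}[(η(μ + Z; τ) − μ)²]`. -/
noncomputable def stRisk (G : Measure ℝ) (τ : ℝ) : ℝ :=
  ∫ m, (∫ z, (softThr (m + z) τ - m) ^ 2 * gaussPDF z) ∂G

/-- Continuous form of the soft-thresholding function, valid for `0 ≤ τ`. -/
noncomputable def sgap (x τ : ℝ) : ℝ := max (x - τ) 0 - max (-x - τ) 0

lemma softThr_eq {x τ : ℝ} (h : 0 ≤ τ) : softThr x τ = sgap x τ := by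
  unfold softThr sgap
  rcases lt_trichotomy x 0 with hx | hx | hx
  · rw [Real.sign_of_neg hx, abs_of_neg hx, max_eq_right (by linarith : x - τ ≤ 0)]; ring
  · subst hx; simp
  · rw [Real.sign_of_pos hx, abs_of_pos hx, max_eq_right (by linarith : -x - τ ≤ 0)]; ring

lemma sgap_bound {m z τ : ℝ} (h : 0 ≤ τ) : |sgap (m + z) τ - m| ≤ τ + |z| := by
  unfold sgap
  have h1 := le_abs_self z
  have h2 := neg_abs_le z
  rw [abs_le]
  rcases max_cases (m + z - τ) 0 with ⟨e1, f1⟩ | ⟨e1, f1⟩ <;>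
  rcases max_cases (-(m + z) - τ) 0 with ⟨e2, f2⟩ | ⟨e2, f2⟩ <;>
  rw [e1, e2] <;> constructor <;> linarith

lemma sgap_lip {x a b : ℝ} (ha : 0 ≤ a) (hb : 0 ≤ b) : |sgap x a - sgap x b| ≤ |a - b| := by
  unfold sgap
  have h1 := le_abs_self (a - b)
  have h2 := neg_abs_le (a - b)
  rw [abs_le]
  rcases max_cases (x - a) 0 with ⟨e1, f1⟩ | ⟨e1, f1⟩ <;>
  rcases max_cases (-x - a) 0 with ⟨e2, f2⟩ | ⟨e2, f2⟩ <;>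
  rcases max_cases (x - b) 0 with ⟨e3, f3⟩ | ⟨e3, f3⟩ <;>
  rcases max_cases (-x - b) 0 with ⟨e4, f4⟩ | ⟨e4, f4⟩ <;>
  rw [e1, e2, e3, e4] <;> constructor <;> linarith

lemma gaussPDF_nonneg (z : ℝ) : 0 ≤ gaussPDF z := by unfold gaussPDF; positivity

lemma gaussPDF_cont : Continuous gaussPDF := by unfold gaussPDF; fun_prop

/-- Integrand of the risk. -/
noncomputable def Fint (τ : ℝ) (p : ℝ × ℝ) : ℝ := (sgap (p.1 + p.2) τ - p.1) ^ 2 * gaussPDF p.2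

/-- Derivative of the integrand. -/
noncomputable def Fder (τ : ℝ) (p : ℝ × ℝ) : ℝ :=
  (if τ < p.1 + p.2 then 2 * (τ - p.2) else if p.1 + p.2 < -τ then 2 * (p.2 + τ) else 0)
    * gaussPDF p.2

lemma Fint_lip {a b R : ℝ} (p : ℝ × ℝ) (ha : 0 ≤ a) (hb : 0 ≤ b) (haR : a ≤ R) (hbR : b ≤ R) :
    |Fint a p - Fint b p| ≤ (2 * (R + |p.2|) * gaussPDF p.2) * |a - b| := by
  have e : Fint a p - Fint b p = ((sgap (p.1 + p.2) a - sgap (p.1 + p.2) b) *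
     ((sgap (p.1 + p.2) a - p.1) + (sgap (p.1 + p.2) b - p.1))) * gaussPDF p.2 := by
    unfold Fint; ring
  have h0 := gaussPDF_nonneg p.2
  have h1 := sgap_lip (x := p.1 + p.2) ha hb
  have h2 := sgap_bound (m := p.1) (z := p.2) ha
  have h3 := sgap_bound (m := p.1) (z := p.2) hb
  have h4 := abs_add_le (sgap (p.1 + p.2) a - p.1) (sgap (p.1 + p.2) b - p.1)
  rw [e, abs_mul, abs_mul, abs_of_nonneg h0]
  calc _ ≤ (|a - b| * (2 * (R + |p.2|))) * gaussPDF p.2 := by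
        gcongr
        linarith
    _ = _ := by ring

lemma sgap_deriv {x τ : ℝ} (hτ : 0 < τ) (h1 : x ≠ τ) (h2 : x ≠ -τ) :
    HasDerivAt (sgap x) (if τ < x then -1 else if x < -τ then 1 else 0) τ := by
  split_ifs with h3 h4
  · have : HasDerivAt (fun t => x - t) (-1) τ := by simpa using (hasDerivAt_id τ).const_sub x
    refine this.congr_of_eventuallyEq ?_
    filter_upwards [lt_mem_nhds hτ, gt_mem_nhds h3] with t ht ht'
    unfold sgap
    rw [max_eq_left (by linarith), max_eq_right (by linarith)]; ring
  · have : HasDerivAt (fun t => x + t) 1 τ := by simpa using (hasDerivAt_id τ).const_add x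
    refine this.congr_of_eventuallyEq ?_
    filter_upwards [lt_mem_nhds hτ, gt_mem_nhds (show τ < -x by linarith)] with t ht ht'
    unfold sgap
    rw [max_eq_right (by linarith), max_eq_left (by linarith)]; ring
  · have h3' : x < τ := lt_of_le_of_ne (not_lt.1 h3) h1
    have h4' : -τ < x := lt_of_le_of_ne (not_lt.1 h4) (Ne.symm h2)
    refine (hasDerivAt_const τ (0 : ℝ)).congr_of_eventuallyEq ?_
    filter_upwards [lt_mem_nhds h3', lt_mem_nhds (show -x < τ by linarith)] with t ht ht'
    unfold sgap
    rw [max_eq_right (by linarith), max_eq_right (by linarith)]; ring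

lemma Fint_deriv {τ : ℝ} (p : ℝ × ℝ) (hτ : 0 < τ) (h1 : p.1 + p.2 ≠ τ) (h2 : p.1 + p.2 ≠ -τ) :
    HasDerivAt (fun t => Fint t p) (Fder τ p) τ := by
  have h := (((sgap_deriv hτ h1 h2).sub_const p.1).pow 2).mul_const (gaussPDF p.2)
  unfold Fint
  refine h.congr_deriv ?_
  unfold Fder sgap
  congr 1
  split_ifs with h3 h4
  · rw [max_eq_left (by linarith), max_eq_right (by linarith)]; push_cast; ring
  · rw [max_eq_right (by linarith), max_eq_left (by linarith)]; push_cast; ring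
  · simp

lemma int_gauss : Integrable gaussPDF := by
  have := (integrable_exp_neg_mul_sq (b := 1/2) (by norm_num)).div_const (Real.sqrt (2 * Real.pi))
  refine this.congr (Filter.Eventually.of_forall fun z => ?_)
  simp only [gaussPDF]; congr 2; ring

lemma int_abs : Integrable (fun u : ℝ => |u| * Real.exp (-u ^ 2 / 2)) := by
  have := (integrable_mul_exp_neg_mul_sq (b := 1/2) (by norm_num)).abs
  refine this.congr (Filter.Eventually.of_forall fun z => ?_)
  simp only [abs_mul, Real.abs_exp]; congr 2; ring

lemma int_sq : Integrable (fun u : ℝ => u ^ 2 * Real.exp (-u ^ 2 / 2)) := by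
  have := (integrable_rpow_mul_exp_neg_mul_sq (b := 1/2) (by norm_num) (s := 2) (by norm_num))
  refine this.congr (Filter.Eventually.of_forall fun z => ?_)
  simp only [Real.rpow_two]; congr 2; ring

lemma int_bound (R : ℝ) : Integrable (fun z => 2 * (R + |z|) * gaussPDF z) := by
  have := (int_gauss.const_mul (2 * R)).add
    ((int_abs.div_const (Real.sqrt (2 * Real.pi))).const_mul 2)
  refine this.congr (Filter.Eventually.of_forall fun z => ?_)
  simp only [gaussPDF, Pi.add_apply]; ring

lemma int_bound2 (R : ℝ) : Integrable (fun z => (R + |z|) ^ 2 * gaussPDF z) := by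
  have := ((int_gauss.const_mul (R ^ 2)).add
    ((int_abs.div_const (Real.sqrt (2 * Real.pi))).const_mul (2 * R))).add
    (int_sq.div_const (Real.sqrt (2 * Real.pi)))
  refine this.congr (Filter.Eventually.of_forall fun z => ?_)
  simp only [gaussPDF, Pi.add_apply]
  rw [← sq_abs z]; ring

lemma Fint_cont (τ : ℝ) : Continuous (Fint τ) := by
  have := gaussPDF_cont
  unfold Fint sgap; fun_prop

lemma Fint_int (G : Measure ℝ) [IsProbabilityMeasure G] {τ : ℝ} (hτ : 0 ≤ τ) :
    Integrable (Fint τ) (G.prod volume) := by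
  refine ((int_bound2 τ).comp_snd G).mono' (Fint_cont τ).aestronglyMeasurable
    (Filter.Eventually.of_forall fun p => ?_)
  have h0 := gaussPDF_nonneg p.2
  unfold Fint
  rw [Real.norm_eq_abs, abs_mul, abs_of_nonneg h0, abs_pow]
  have := sgap_bound (m := p.1) (z := p.2) hτ
  gcongr

lemma Fder_meas (τ : ℝ) : Measurable (Fder τ) := by
  have := gaussPDF_cont.measurable
  unfold Fder
  refine Measurable.mul ?_ (by fun_prop)
  refine Measurable.ite (measurableSet_lt (by fun_prop) (by fun_prop)) (by fun_prop) ?_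
  exact Measurable.ite (measurableSet_lt (by fun_prop) (by fun_prop)) (by fun_prop) (by fun_prop)

lemma risk_deriv (G : Measure ℝ) [IsProbabilityMeasure G] {τ : ℝ} (hτ : 0 < τ) :
    Integrable (Fder τ) (G.prod volume) ∧
    HasDerivAt (stRisk G) (∫ p, Fder τ p ∂(G.prod volume)) τ := by
  have key := hasDerivAt_integral_of_dominated_loc_of_lip (μ := G.prod volume) (F := Fint)
    (F' := Fder τ) (x₀ := τ) (s := Set.Ioo 0 (τ + 1))
    (bound := fun p => 2 * ((τ + 1) + |p.2|) * gaussPDF p.2)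
    (Ioo_mem_nhds hτ (by linarith))
    (Filter.Eventually.of_forall fun t => (Fint_cont t).aestronglyMeasurable)
    (Fint_int G hτ.le) (Fder_meas τ).aestronglyMeasurable
    (Filter.Eventually.of_forall fun p => by
      refine LipschitzOnWith.of_dist_le_mul fun a ha b hb => ?_
      rw [Real.dist_eq, Real.dist_eq, Real.coe_nnabs]
      refine (Fint_lip p ha.1.le hb.1.le ha.2.le hb.2.le).trans ?_
      gcongr
      exact le_abs_self _)
    ((int_bound (τ + 1)).comp_snd G)
    (by
      have : ∀ᵐ p ∂(G.prod volume), p.1 + p.2 ≠ τ ∧ p.1 + p.2 ≠ -τ := by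
        rw [Measure.ae_prod_iff_ae_ae]
        · refine Filter.Eventually.of_forall fun m => ?_
          have h1 : ∀ᵐ z : ℝ, z ≠ τ - m := Measure.ae_ne volume _
          have h2 : ∀ᵐ z : ℝ, z ≠ -τ - m := Measure.ae_ne volume _
          filter_upwards [h1, h2] with z a b
          exact ⟨fun h => a (by linarith), fun h => b (by linarith)⟩
        · refine MeasurableSet.inter ?_ ?_
          · exact (measurableSet_eq_fun (by fun_prop) (by fun_prop)).compl
          · exact (measurableSet_eq_fun (by fun_prop) (by fun_prop)).compl
      filter_upwards [this] with p hp
      exact Fint_deriv p hτ hp.1 hp.2)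
  refine ⟨key.1, key.2.congr_of_eventuallyEq ?_⟩
  filter_upwards [lt_mem_nhds hτ] with t ht
  rw [integral_prod _ (Fint_int G ht.le)]
  simp only [stRisk, Fint, softThr_eq ht.le]

/-- Unnormalised gaussian first-moment kernel. -/
noncomputable def gker (u : ℝ) : ℝ := |u| * Real.exp (-u ^ 2 / 2)

lemma gker_nonneg (u : ℝ) : 0 ≤ gker u := by unfold gker; positivity

lemma tail_le {τ u : ℝ} (hτ : 0 ≤ τ) (hu : 0 ≤ u) :
    u * gaussPDF (τ + u) ≤ gaussPDF τ * gker u := by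
  unfold gaussPDF gker
  rw [abs_of_nonneg hu]
  have : Real.exp (-(τ + u) ^ 2 / 2) ≤ Real.exp (-τ ^ 2 / 2) * Real.exp (-u ^ 2 / 2) := by
    rw [← Real.exp_add]; gcongr; nlinarith [mul_nonneg hτ hu]
  calc u * (Real.exp (-(τ + u) ^ 2 / 2) / Real.sqrt (2 * Real.pi))
      ≤ u * ((Real.exp (-τ ^ 2 / 2) * Real.exp (-u ^ 2 / 2)) / Real.sqrt (2 * Real.pi)) := by
        gcongr
    _ = _ := by ring

lemma gaussPDF_neg (z : ℝ) : gaussPDF (-z) = gaussPDF z := by simp [gaussPDF]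
lemma gker_neg (z : ℝ) : gker (-z) = gker z := by simp [gker]

lemma bump_le {τ δ z : ℝ} (hδ : 0 < δ) (hτ : δ ≤ τ)
    (hz : z ∈ Set.Icc (τ - δ) (τ - δ / 2)) :
    gaussPDF τ * Real.exp (τ * δ / 2 - δ ^ 2 / 8) ≤ gaussPDF z := by
  unfold gaussPDF
  rw [div_mul_eq_mul_div, ← Real.exp_add]
  gcongr
  nlinarith [hz.1, hz.2, mul_nonneg (sub_nonneg.2 hz.2) (by linarith [hz.1] : 0 ≤ τ - δ / 2 + z)]

/-- Pointwise lower bound for the derivative of the integrand. -/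
noncomputable def LB (τ δ : ℝ) (p : ℝ × ℝ) : ℝ :=
  gaussPDF τ * (δ * Real.exp (τ * δ / 2 - δ ^ 2 / 8) *
    ((Set.Ioi δ).indicator 1 p.1 * (Set.Icc (τ - δ) (τ - δ / 2)).indicator 1 p.2)
    - (2 * gker (p.2 - τ) + 2 * gker (p.2 + τ)))

lemma LB_le {τ δ : ℝ} (hδ : 0 < δ) (hτ : δ ≤ τ) (p : ℝ × ℝ) (hp : 0 ≤ p.1) :
    LB τ δ p ≤ Fder τ p := by
  obtain ⟨m, z⟩ := p
  simp only at hp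
  have g0 := gaussPDF_nonneg τ
  have k1 := mul_nonneg g0 (gker_nonneg (z - τ))
  have k2 := mul_nonneg g0 (gker_nonneg (z + τ))
  have hz0 := gaussPDF_nonneg z
  by_cases hI : δ < m ∧ z ∈ Set.Icc (τ - δ) (τ - δ / 2)
  · have hb := bump_le hδ hτ hI.2
    have h1 : τ < m + z := by linarith [hI.1, hI.2.1]
    have e1 : (Set.Ioi δ).indicator (1 : ℝ → ℝ) m = 1 := by simp [hI.1]
    have e2 : (Set.Icc (τ - δ) (τ - δ / 2)).indicator (1 : ℝ → ℝ) z = 1 := by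
      rw [Set.indicator_of_mem hI.2]; rfl
    simp only [LB, Fder, e1, e2, if_pos h1]
    have : δ * gaussPDF z ≤ 2 * (τ - z) * gaussPDF z := by
      gcongr; linarith [hI.2.2]
    have := mul_le_mul_of_nonneg_left hb hδ.le
    linarith
  · have e : (Set.Ioi δ).indicator (1 : ℝ → ℝ) m *
        (Set.Icc (τ - δ) (τ - δ / 2)).indicator (1 : ℝ → ℝ) z = 0 := by
      by_cases hm : δ < m
      · have : z ∉ Set.Icc (τ - δ) (τ - δ / 2) := fun h => hI ⟨hm, h⟩
        rw [Set.indicator_of_notMem this, mul_zero]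
      · rw [Set.indicator_of_notMem (by simpa using hm), zero_mul]
    simp only [LB, Fder, e]
    split_ifs with h3 h4
    · by_cases hz : z ≤ τ
      · have : 0 ≤ 2 * (τ - z) * gaussPDF z := mul_nonneg (by linarith) hz0
        linarith
      · have := tail_le (τ := τ) (u := z - τ) (by linarith) (by linarith)
        rw [show τ + (z - τ) = z by ring] at this
        linarith
    · have := tail_le (τ := τ) (u := -(z + τ)) (by linarith) (by linarith)
      rw [show τ + -(z + τ) = -z by ring, gaussPDF_neg, gker_neg] at this
      linarith
    · linarith

lemma LB_integral (G : Measure ℝ) [IsProbabilityMeasure G] {τ δ : ℝ} (hδ : 0 < δ) :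
    Integrable (LB τ δ) (G.prod volume) ∧ ∫ p, LB τ δ p ∂(G.prod volume) =
      gaussPDF τ * (δ * Real.exp (τ * δ / 2 - δ ^ 2 / 8) * (G.real (Set.Ioi δ) * (δ / 2))
        - 4 * ∫ u, gker u) := by
  have i1 : Integrable ((Set.Ioi δ).indicator (1 : ℝ → ℝ)) G :=
    (integrable_const (1 : ℝ)).indicator measurableSet_Ioi
  have i2 : Integrable ((Set.Icc (τ - δ) (τ - δ / 2)).indicator (1 : ℝ → ℝ)) volume := by
    rw [integrable_indicator_iff measurableSet_Icc]
    exact integrableOn_const (by simp)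
  have i3 := i1.mul_prod i2
  have j1 : Integrable (fun z => gker (z - τ)) := int_abs.comp_sub_right τ
  have j2 : Integrable (fun z => gker (z + τ)) := int_abs.comp_add_right τ
  have j3 := ((j1.const_mul 2).add (j2.const_mul 2))
  have j4 : Integrable (fun p : ℝ × ℝ => 2 * gker (p.2 - τ) + 2 * gker (p.2 + τ))
      (G.prod volume) := j3.comp_snd G
  have i4 := i3.const_mul (δ * Real.exp (τ * δ / 2 - δ ^ 2 / 8))
  refine ⟨(i4.sub j4).const_mul _, ?_⟩
  have e1 : ∫ p, LB τ δ p ∂(G.prod volume) = gaussPDF τ *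
      ((∫ p : ℝ × ℝ, δ * Real.exp (τ * δ / 2 - δ ^ 2 / 8) *
    ((Set.Ioi δ).indicator 1 p.1 * (Set.Icc (τ - δ) (τ - δ / 2)).indicator 1 p.2) ∂(G.prod volume))
      - ∫ p : ℝ × ℝ, (2 * gker (p.2 - τ) + 2 * gker (p.2 + τ)) ∂(G.prod volume)) := by
    rw [← integral_sub i4 j4, ← integral_const_mul]
    rfl
  have e2 : ∫ p : ℝ × ℝ, (2 * gker (p.2 - τ) + 2 * gker (p.2 + τ)) ∂(G.prod volume)
      = 4 * ∫ u, gker u := by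
    rw [integral_fun_snd (fun z => 2 * gker (z - τ) + 2 * gker (z + τ)),
      integral_add (j1.const_mul 2) (j2.const_mul 2), integral_const_mul, integral_const_mul,
      integral_sub_right_eq_self gker, integral_add_right_eq_self gker]
    simp; ring
  rw [e1, e2, integral_const_mul, integral_prod_mul, integral_indicator_one measurableSet_Ioi,
    integral_indicator_one measurableSet_Icc, Real.volume_real_Icc_of_le (by linarith)]
  congr 4
  ring

/-- if `μ ≥ 0` almost surely and `P(μ > 0) > 0`, then there is a finite
threshold `T ≥ 0` beyond which the derivative of the soft-thresholding risk is positive. -/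
theorem stRisk_deriv_eventually_pos (G : Measure ℝ) [IsProbabilityMeasure G]
    (hG : Integrable (fun m => m ^ 2) G)
    (hnn : ∀ᵐ m ∂G, 0 ≤ m) (hpos : 0 < G {m : ℝ | 0 < m}) :
    ∃ T : ℝ, 0 ≤ T ∧ ∀ τ : ℝ, T < τ → 0 < deriv (stRisk G) τ := by
  obtain ⟨δ, hδ, hGδ⟩ : ∃ δ : ℝ, 0 < δ ∧ 0 < G.real (Set.Ioi δ) := by
    by_contra! hcon
    have hz : ∀ n : ℕ, G (Set.Ioi (1 / ((n : ℝ) + 1))) = 0 := fun n => by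
      have h1 := hcon (1 / ((n : ℝ) + 1)) (by positivity)
      exact (measureReal_eq_zero_iff).1 (le_antisymm h1 measureReal_nonneg)
    have hU := measure_iUnion_null hz
    refine hpos.ne' (measure_mono_null (fun m hm => ?_) hU)
    obtain ⟨n, hn⟩ := exists_nat_one_div_lt (show (0 : ℝ) < m from hm)
    exact Set.mem_iUnion.2 ⟨n, hn⟩
  have hlim : Filter.Tendsto (fun τ : ℝ => δ * Real.exp (τ * δ / 2 - δ ^ 2 / 8) *
      (G.real (Set.Ioi δ) * (δ / 2))) Filter.atTop Filter.atTop := by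
    refine Filter.Tendsto.atTop_mul_const (by positivity) ?_
    refine Filter.Tendsto.const_mul_atTop hδ (Real.tendsto_exp_atTop.comp ?_)
    refine Filter.tendsto_atTop_add_const_right _ _ ?_
    exact (Filter.tendsto_id.atTop_mul_const hδ).atTop_div_const (by norm_num)
  obtain ⟨T, hT⟩ := Filter.eventually_atTop.1 (hlim.eventually_gt_atTop (4 * ∫ u, gker u))
  refine ⟨max T δ, le_max_of_le_right hδ.le, fun τ hτ => ?_⟩
  have hτ1 : T ≤ τ := (le_max_left _ _).trans hτ.le
  have hτ2 : δ ≤ τ := (le_max_right _ _).trans hτ.le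
  obtain ⟨hi, hd⟩ := risk_deriv G (hδ.trans_le hτ2)
  rw [hd.deriv]
  obtain ⟨hLi, hLe⟩ := LB_integral G (τ := τ) hδ
  have hae : ∀ᵐ p ∂(G.prod (volume : Measure ℝ)), 0 ≤ p.1 :=
    Measure.quasiMeasurePreserving_fst.ae hnn
  have hle : ∫ p, LB τ δ p ∂(G.prod volume) ≤ ∫ p, Fder τ p ∂(G.prod volume) :=
    integral_mono_ae hLi hi (hae.mono fun p hp => LB_le hδ hτ2 p hp)
  refine lt_of_lt_of_le ?_ hle
  rw [hLe]
  have : 0 < gaussPDF τ := by unfold gaussPDF; positivity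
  exact mul_pos this (sub_pos.2 (hT τ hτ1))
end

section
/- Suppose P(μ ≠ 0) > 0. Then the derivative of the soft-thresholding risk τ ↦ r(τ; G) has exactly one sign change on [0, ∞): there exists τ* ∈ (0, ∞) such that ∂r(τ; G)/∂τ < 0 for all τ ∈ [0, τ*) and ∂r(τ; G)/∂τ > 0 for all τ > τ*. Consequently r(·; G) is bowl-shaped: it attains its global minimum over [0, ∞) at τ*, is nonincreasing on [0, τ*], and is nondecreasing on [τ*, ∞). -/
open MeasureTheory

namespace STB
open Set Filter Topology

lemma phi_pos (z : ℝ) : 0 < gaussPDF z := by unfold gaussPDF; positivity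

lemma phi_even (z : ℝ) : gaussPDF (-z) = gaussPDF z := by simp [gaussPDF]

lemma phi_le_one (z : ℝ) : gaussPDF z ≤ 1 := by
  unfold gaussPDF
  have h1 : Real.exp (-z ^ 2 / 2) ≤ 1 := Real.exp_le_one_iff.2 (by nlinarith [sq_nonneg z])
  have h2 : 1 ≤ Real.sqrt (2 * Real.pi) := by
    rw [Real.one_le_sqrt]; nlinarith [Real.pi_gt_three]
  rw [div_le_one (by linarith)]; linarith

lemma phi_deriv (z : ℝ) : HasDerivAt gaussPDF (-(z * gaussPDF z)) z := by
  unfold gaussPDF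
  have h : HasDerivAt (fun z : ℝ => -z ^ 2 / 2) (-z) z := by
    have := ((hasDerivAt_pow 2 z).neg).div_const 2
    refine this.congr_deriv ?_
    push_cast; ring
  have := (h.exp).div_const (Real.sqrt (2 * Real.pi))
  refine this.congr_deriv ?_
  ring

lemma phi_cont : Continuous gaussPDF :=
  continuous_iff_continuousAt.2 fun z => (phi_deriv z).continuousAt

lemma phi_eq (z : ℝ) : gaussPDF z = Real.exp (-(1/2) * z ^ 2) * (Real.sqrt (2 * Real.pi))⁻¹ := by
  unfold gaussPDF; rw [div_eq_mul_inv]; congr 2; ring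

lemma phi_int : Integrable gaussPDF := by
  have := (integrable_exp_neg_mul_sq (b := 1/2) (by norm_num)).mul_const (Real.sqrt (2 * Real.pi))⁻¹
  exact this.congr (Eventually.of_forall fun z => (phi_eq z).symm)

lemma phi_int1 : Integrable (fun z => z * gaussPDF z) := by
  have := (integrable_mul_exp_neg_mul_sq (b := 1/2) (by norm_num)).mul_const (Real.sqrt (2 * Real.pi))⁻¹
  refine this.congr (Eventually.of_forall fun z => ?_)
  simp only [phi_eq]; ring

lemma phi_int2 : Integrable (fun z => z ^ 2 * gaussPDF z) := by
  have := (integrable_rpow_mul_exp_neg_mul_sq (b := 1/2) (by norm_num) (s := 2) (by norm_num)).mul_const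
    (Real.sqrt (2 * Real.pi))⁻¹
  refine this.congr (Eventually.of_forall fun z => ?_)
  simp only [phi_eq, Real.rpow_two]; ring

lemma phi_total : ∫ z, gaussPDF z = 1 := by
  simp_rw [phi_eq]
  rw [integral_mul_const, integral_gaussian]
  have : Real.pi / (1/2) = 2 * Real.pi := by ring
  rw [this]
  exact mul_inv_cancel₀ (by positivity)

noncomputable def Q (a : ℝ) : ℝ := ∫ z in Ioi a, gaussPDF z

lemma Q_nonneg (a : ℝ) : 0 ≤ Q a := setIntegral_nonneg measurableSet_Ioi fun z _ => (phi_pos z).le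

lemma Q_le_one (a : ℝ) : Q a ≤ 1 := by
  rw [← phi_total]
  exact setIntegral_le_integral phi_int (Eventually.of_forall fun z => (phi_pos z).le)

lemma Q_deriv (a : ℝ) : HasDerivAt Q (-gaussPDF a) a := by
  have h : Q = fun a => Q 0 - ∫ z in (0:ℝ)..a, gaussPDF z := by
    funext a
    have := intervalIntegral.integral_interval_add_Ioi (a := 0) (b := a) (μ := volume)
      phi_int.integrableOn phi_int.integrableOn
    unfold Q; linarith
  rw [h]
  have := (intervalIntegral.integral_hasDerivAt_right (a := 0) (b := a) phi_int.intervalIntegrable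
    (phi_cont.stronglyMeasurableAtFilter _ _) phi_cont.continuousAt)
  simpa using this.const_sub (Q 0)

lemma Q_cont : Continuous Q :=
  continuous_iff_continuousAt.2 fun z => (Q_deriv z).continuousAt

lemma phi_m1 (a : ℝ) : ∫ z in Ioi a, z * gaussPDF z = gaussPDF a := by
  have hd : ∀ x ∈ Ioi a, HasDerivAt (fun z => -gaussPDF z) (x * gaussPDF x) x := fun x _ => by
    exact (phi_deriv x).neg.congr_deriv (by ring)
  have ht := tendsto_zero_of_hasDerivAt_of_integrableOn_Ioi hd phi_int1.integrableOn
    phi_int.neg.integrableOn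
  have := integral_Ioi_of_hasDerivAt_of_tendsto phi_cont.neg.continuousWithinAt hd
    phi_int1.integrableOn ht
  rw [this]; simp

lemma phi_m2 (a : ℝ) : ∫ z in Ioi a, z ^ 2 * gaussPDF z = a * gaussPDF a + Q a := by
  have hd : ∀ x ∈ Ioi a, HasDerivAt (fun z => -(z * gaussPDF z))
      (x ^ 2 * gaussPDF x - gaussPDF x) x := fun x _ => by
    have := ((hasDerivAt_id x).mul (phi_deriv x)).neg
    refine this.congr_deriv ?_
    simp only [id]; ring
  have hi : IntegrableOn (fun x => x ^ 2 * gaussPDF x - gaussPDF x) (Ioi a) :=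
    (phi_int2.sub phi_int).integrableOn
  have ht := tendsto_zero_of_hasDerivAt_of_integrableOn_Ioi hd hi
    phi_int1.neg.integrableOn
  have := integral_Ioi_of_hasDerivAt_of_tendsto
    (f := fun z => -(z * gaussPDF z))
    (continuous_id.mul phi_cont).neg.continuousWithinAt hd hi ht
  rw [integral_sub phi_int2.integrableOn phi_int.integrableOn] at this
  unfold Q; linarith

lemma Q_lower (a : ℝ) : ∫ z in Iio (-a), gaussPDF z = Q a := by
  rw [← integral_Iic_eq_integral_Iio, ← integral_comp_neg_Ioi a gaussPDF]
  simp_rw [phi_even]; rfl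

lemma phi_m1_lower (a : ℝ) : ∫ z in Iio (-a), z * gaussPDF z = -gaussPDF a := by
  rw [← integral_Iic_eq_integral_Iio, ← integral_comp_neg_Ioi a (fun z => z * gaussPDF z)]
  simp_rw [phi_even, neg_mul]
  rw [integral_neg, phi_m1]

lemma pos_of_Ioi (a : ℝ) (f : ℝ → ℝ) (hi : IntegrableOn f (Ioi a)) (hf : ∀ x ∈ Ioi a, 0 < f x) :
    0 < ∫ z in Ioi a, f z := by
  rw [setIntegral_pos_iff_support_of_nonneg_ae _ hi]
  · have : Function.support f ∩ Ioi a = Ioi a := by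
      apply inter_eq_right.2; intro x hx; exact (hf x hx).ne'
    rw [this]; simp
  · exact (ae_restrict_iff' measurableSet_Ioi).2 (Eventually.of_forall fun x hx => (hf x hx).le)

lemma Q_pos (a : ℝ) : 0 < Q a := pos_of_Ioi a _ phi_int.integrableOn fun x _ => phi_pos x

noncomputable def B (t : ℝ) : ℝ := gaussPDF t - t * Q t

lemma B_pos (t : ℝ) : 0 < B t := by
  have hi : Integrable (fun z => z * gaussPDF z - t * gaussPDF z) := phi_int1.sub (phi_int.const_mul t)
  have := pos_of_Ioi t _ hi.integrableOn fun x hx => by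
    have := mul_pos (sub_pos.2 hx) (phi_pos x); linarith
  rw [integral_sub phi_int1.integrableOn (phi_int.const_mul t).integrableOn, phi_m1,
    integral_const_mul] at this
  exact this

lemma mills (t : ℝ) : 0 < (1 + t ^ 2) * Q t - t * gaussPDF t := by
  have i1 := (phi_int1.const_mul (2*t))
  have i2 := (phi_int.const_mul (t^2))
  have hi : Integrable (fun z => z ^ 2 * gaussPDF z - 2 * t * (z * gaussPDF z) + t ^ 2 * gaussPDF z) :=
    (phi_int2.sub i1).add i2
  have i3 : Integrable (fun z => z ^ 2 * gaussPDF z - 2 * t * (z * gaussPDF z)) := phi_int2.sub i1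
  have := pos_of_Ioi t _ hi.integrableOn fun x hx => by
    have := mul_pos (pow_pos (sub_pos.2 hx) 2) (phi_pos x)
    linarith
  rw [integral_add i3.integrableOn i2.integrableOn,
    integral_sub phi_int2.integrableOn i1.integrableOn,
    integral_const_mul, integral_const_mul, phi_m2, phi_m1] at this
  change 0 < _ + t ^ 2 * Q t at this
  linarith

noncomputable def A (m t : ℝ) : ℝ :=
  t * (Q (t - m) + Q (t + m)) - (gaussPDF (t - m) + gaussPDF (t + m))

lemma A_neg (m t : ℝ) : A (-m) t = A m t := by
  unfold A; rw [sub_neg_eq_add, ← sub_eq_add_neg]; ring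

lemma A_abs (m t : ℝ) : A |m| t = A m t := by
  rcases abs_choice m with h | h <;> rw [h]; exact A_neg m t

lemma A_zero (t : ℝ) : A 0 t = -2 * B t := by
  unfold A B; simp; ring

lemma B_deriv (t : ℝ) : HasDerivAt B (-Q t) t := by
  have := (phi_deriv t).sub ((hasDerivAt_id t).mul (Q_deriv t))
  refine this.congr_deriv ?_
  simp only [id]; ring

lemma dsub {f : ℝ → ℝ} {f' m t : ℝ} (h : HasDerivAt f f' (t - m)) :
    HasDerivAt (fun t => f (t - m)) f' t := HasDerivAt.comp_sub_const t m h
lemma dadd {f : ℝ → ℝ} {f' m t : ℝ} (h : HasDerivAt f f' (t + m)) :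
    HasDerivAt (fun t => f (t + m)) f' t := HasDerivAt.comp_add_const t m h
lemma dsub' {f : ℝ → ℝ} {f' m t : ℝ} (h : HasDerivAt f f' (t - m)) :
    HasDerivAt (fun m => f (t - m)) (-f') m := HasDerivAt.comp_const_sub t m h
lemma dadd' {f : ℝ → ℝ} {f' m t : ℝ} (h : HasDerivAt f f' (t + m)) :
    HasDerivAt (fun m => f (t + m)) f' m := HasDerivAt.comp_const_add t m h

lemma A_deriv (m t : ℝ) : HasDerivAt (A m)
    (Q (t - m) + Q (t + m) - m * (gaussPDF (t - m) - gaussPDF (t + m))) t := by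
  have := ((hasDerivAt_id t).mul ((dsub (Q_deriv (t - m))).add (dadd (Q_deriv (t + m))))).sub
    ((dsub (phi_deriv (t - m))).add (dadd (phi_deriv (t + m))))
  refine this.congr_deriv ?_
  simp only [id, Pi.add_apply]; ring

lemma A_deriv' (m t : ℝ) : HasDerivAt (fun m => A m t)
    (m * (gaussPDF (t - m) + gaussPDF (t + m))) m := by
  have := (((dsub' (Q_deriv (t - m))).add (dadd' (Q_deriv (t + m)))).const_mul t).sub
    ((dsub' (phi_deriv (t - m))).add (dadd' (phi_deriv (t + m))))
  refine this.congr_deriv ?_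
  ring

lemma A_mono {t a b : ℝ} (ha : 0 ≤ a) (hab : a ≤ b) : A a t ≤ A b t := by
  have : MonotoneOn (fun m => A m t) (Ici 0) := by
    apply monotoneOn_of_deriv_nonneg (convex_Ici 0)
    · exact fun x _ => (A_deriv' x t).continuousAt.continuousWithinAt
    · exact fun x _ => (A_deriv' x t).differentiableAt.differentiableWithinAt
    · intro x hx
      rw [interior_Ici] at hx
      rw [(A_deriv' x t).deriv]
      exact mul_nonneg (le_of_lt hx) (add_pos (phi_pos _) (phi_pos _)).le
  exact this ha (ha.trans hab) hab

lemma phi_anti {t m : ℝ} (ht : 0 ≤ t) (hm : 0 ≤ m) : gaussPDF (t + m) ≤ gaussPDF (t - m) := by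
  unfold gaussPDF
  apply div_le_div_of_nonneg_right _ (Real.sqrt_nonneg _)
  apply Real.exp_le_exp.2
  nlinarith [mul_nonneg ht hm]

noncomputable def F (t m : ℝ) : ℝ :=
  gaussPDF t * (Q (t - m) + Q (t + m)) - Q t * (gaussPDF (t - m) + gaussPDF (t + m))
    - B t * (m * (gaussPDF (t - m) - gaussPDF (t + m)))

lemma F_deriv (t m : ℝ) : HasDerivAt (F t)
    (m * ((gaussPDF (t - m) + gaussPDF (t + m)) * ((1 + t ^ 2) * Q t - t * gaussPDF t)
      + B t * (m * (gaussPDF (t - m) - gaussPDF (t + m))))) m := by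
  have h1 := ((dsub' (Q_deriv (t - m))).add (dadd' (Q_deriv (t + m)))).const_mul (gaussPDF t)
  have h2 := ((dsub' (phi_deriv (t - m))).add (dadd' (phi_deriv (t + m)))).const_mul (Q t)
  have h3 := ((hasDerivAt_id m).mul
    ((dsub' (phi_deriv (t - m))).sub (dadd' (phi_deriv (t + m))))).const_mul (B t)
  refine ((h1.sub h2).sub h3).congr_deriv ?_
  simp only [id, B, Pi.sub_apply]; ring

lemma F_pos {t m : ℝ} (ht : 0 ≤ t) (hm : 0 < m) : 0 < F t m := by
  have : StrictMonoOn (F t) (Ici 0) := by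
    apply strictMonoOn_of_deriv_pos (convex_Ici 0)
    · exact fun x _ => (F_deriv t x).continuousAt.continuousWithinAt
    · intro x hx
      rw [interior_Ici] at hx
      have hx : 0 < x := hx
      rw [(F_deriv t x).deriv]
      have := sub_nonneg.2 (phi_anti ht hx.le)
      have h1 := mul_pos (add_pos (phi_pos (t - x)) (phi_pos (t + x))) (mills t)
      have h2 := mul_nonneg (B_pos t).le (mul_nonneg hx.le this)
      exact mul_pos hx (by linarith)
  have h := this (mem_Ici.2 le_rfl) hm.le hm
  have h0 : F t 0 = 0 := by unfold F; simp; ring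
  linarith

lemma R_strict {m : ℝ} (hm : m ≠ 0) : StrictMonoOn (fun t => A m t / B t) (Ici 0) := by
  have hm' : 0 < |m| := abs_pos.2 hm
  simp_rw [← A_abs m]
  have hd : ∀ t, HasDerivAt (fun t => A |m| t / B t) (F t |m| / B t ^ 2) t := fun t => by
    refine ((A_deriv |m| t).div (B_deriv t) (B_pos t).ne').congr_deriv ?_
    congr 1
    unfold F A B; ring
  apply strictMonoOn_of_deriv_pos (convex_Ici 0)
  · exact fun x _ => (hd x).continuousAt.continuousWithinAt
  · intro x hx
    rw [interior_Ici] at hx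
    rw [(hd x).deriv]
    exact div_pos (F_pos (le_of_lt hx) hm') (pow_pos (B_pos x) 2)

lemma R_mono (m : ℝ) : MonotoneOn (fun t => A m t / B t) (Ici 0) := by
  by_cases hm : m = 0
  · subst hm
    intro a _ b _ _
    simp only [A_zero]
    rw [mul_div_assoc, mul_div_assoc, div_self (B_pos a).ne', div_self (B_pos b).ne']
  · exact (R_strict hm).monotoneOn

/-- lower bound for A. -/
lemma A_lower {e t : ℝ} (he : 0 < e) (ht : 0 ≤ t) :
    gaussPDF t * (-2 + e / 2 * (e / 2 * Real.exp (t * (e / 2) - e ^ 2 / 2))) ≤ A e t := by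
  have key := (convex_Icc (e/2) e).mul_sub_le_image_sub_of_le_deriv (f := fun m => A m t)
    (C := e / 2 * (gaussPDF t * Real.exp (t * (e / 2) - e ^ 2 / 2)))
    (fun x _ => (A_deriv' x t).continuousAt.continuousWithinAt)
    (fun x _ => (A_deriv' x t).differentiableAt.differentiableWithinAt)
    (fun x hx => by
      rw [interior_Icc] at hx
      rw [(A_deriv' x t).deriv]
      have hx1 : e / 2 < x := hx.1
      have hx2 : x < e := hx.2
      have : gaussPDF t * Real.exp (t * (e / 2) - e ^ 2 / 2) ≤ gaussPDF (t - x) := by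
        unfold gaussPDF
        rw [div_mul_eq_mul_div, ← Real.exp_add]
        gcongr
        nlinarith
      have h2 := (phi_pos (t + x)).le
      have h3 := phi_pos t
      apply mul_le_mul hx1.le (by linarith) (by positivity) (by linarith))
    (e/2) (by constructor <;> linarith) e (by constructor <;> linarith) (by linarith)
  have h0 : A 0 t ≤ A (e/2) t := A_mono le_rfl (by linarith)
  rw [A_zero] at h0
  have hB : B t ≤ gaussPDF t := by
    unfold B; have := mul_nonneg ht (Q_nonneg t); linarith
  linarith

lemma A_cont (m : ℝ) : Continuous (A m) :=
  continuous_iff_continuousAt.2 fun z => (A_deriv m z).continuousAt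

lemma A_cont' (t : ℝ) : Continuous (fun m => A m t) :=
  continuous_iff_continuousAt.2 fun z => (A_deriv' z t).continuousAt

end STB

namespace STB
open Set Filter Topology

lemma soft_bound (x t m : ℝ) : |softThr x t - m| ≤ |x - m| + |t| := by
  have h : |softThr x t - x| ≤ |t| := by
    unfold softThr
    rcases lt_trichotomy x 0 with h | h | h
    · rw [Real.sign_of_neg h, abs_of_neg h]
      rcases max_cases (-x - t) 0 with ⟨h1, h2⟩ | ⟨h1, h2⟩ <;> rw [h1]
      · have : -1 * (-x - t) - x = t := by ring
        rw [this]
      · rw [abs_le]; have := le_abs_self t; constructor <;> linarith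
    · subst h; simp
    · rw [Real.sign_of_pos h, abs_of_pos h]
      rcases max_cases (x - t) 0 with ⟨h1, h2⟩ | ⟨h1, h2⟩ <;> rw [h1]
      · have : 1 * (x - t) - x = -t := by ring
        rw [this, abs_neg]
      · rw [abs_le]; have := le_abs_self t; constructor <;> linarith
  have : softThr x t - m = (softThr x t - x) + (x - m) := by ring
  rw [this]
  have := abs_add_le (softThr x t - x) (x - m)
  linarith

lemma soft_lip (x s t : ℝ) : |softThr x s - softThr x t| ≤ |s - t| := by
  unfold softThr
  rw [← mul_sub, abs_mul]
  have h1 : |Real.sign x| ≤ 1 := by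
    rcases Real.sign_apply_eq x with h | h | h <;> rw [h] <;> norm_num
  have h2 : |max (|x| - s) 0 - max (|x| - t) 0| ≤ |s - t| := by
    have := abs_max_sub_max_le_abs (|x| - s) (|x| - t) 0
    have e : |x| - s - (|x| - t) = -(s - t) := by ring
    rwa [e, abs_neg] at this
  calc _ ≤ 1 * |max (|x| - s) 0 - max (|x| - t) 0| := by gcongr
    _ ≤ _ := by rw [one_mul]; exact h2

lemma soft_meas (t : ℝ) : Measurable (fun x => softThr x t) := by
  unfold softThr
  have : Measurable Real.sign := by
    unfold Real.sign
    exact Measurable.ite measurableSet_Iio measurable_const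
      (Measurable.ite measurableSet_Ioi measurable_const measurable_const)
  exact this.mul (by fun_prop)

noncomputable def integrand (t m z : ℝ) : ℝ := (softThr (m + z) t - m) ^ 2 * gaussPDF z

noncomputable def integrand' (t m z : ℝ) : ℝ :=
  (Ioi (max t 0 - m)).indicator (fun z => -2 * (z * gaussPDF z) + 2 * t * gaussPDF z) z +
  (Iio (-(max t 0 + m))).indicator (fun z => 2 * (z * gaussPDF z) + 2 * t * gaussPDF z) z

lemma integrand_meas (t : ℝ) : Measurable (Function.uncurry (integrand t)) := by
  unfold integrand Function.uncurry
  exact ((((soft_meas t).comp (measurable_fst.add measurable_snd)).sub measurable_fst).pow_const 2).mul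
    (phi_cont.measurable.comp measurable_snd)

lemma integrand_meas' (t m : ℝ) : Measurable (integrand t m) := by
  unfold integrand
  exact ((((soft_meas t).comp (measurable_const.add measurable_id)).sub_const m).pow_const 2).mul
    phi_cont.measurable

lemma integrand_nonneg (t m z : ℝ) : 0 ≤ integrand t m z :=
  mul_nonneg (sq_nonneg _) (phi_pos z).le

lemma integrand_bound (t m z : ℝ) : integrand t m z ≤ 2 * (z ^ 2 * gaussPDF z) + 2 * t ^ 2 * gaussPDF z := by
  unfold integrand
  have h := soft_bound (m + z) t m
  rw [add_sub_cancel_left] at h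
  have h2 : (softThr (m + z) t - m) ^ 2 ≤ 2 * z ^ 2 + 2 * t ^ 2 := by
    rw [← sq_abs]
    have : |softThr (m + z) t - m| ^ 2 ≤ (|z| + |t|) ^ 2 := by gcongr
    nlinarith [sq_abs z, sq_abs t, sq_nonneg (|z| - |t|)]
  nlinarith [mul_le_mul_of_nonneg_right h2 (phi_pos z).le]

lemma bound_int (t : ℝ) : Integrable (fun z => 2 * (z ^ 2 * gaussPDF z) + 2 * t ^ 2 * gaussPDF z) :=
  (phi_int2.const_mul 2).add (phi_int.const_mul _)

lemma integrand_int (t m : ℝ) : Integrable (integrand t m) := by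
  refine (bound_int t).mono' (integrand_meas' t m).aestronglyMeasurable (Eventually.of_forall fun z => ?_)
  rw [Real.norm_eq_abs, abs_of_nonneg (integrand_nonneg t m z)]
  exact integrand_bound t m z

lemma integrand_deriv (t m z : ℝ) (h0 : m + z ≠ 0) (h1 : m + z ≠ t) (h2 : m + z ≠ -t) :
    HasDerivAt (fun t => integrand t m z) (integrand' t m z) t := by
  unfold integrand integrand'
  have hs : ∀ {d : ℝ}, HasDerivAt (fun t => softThr (m + z) t) d t →
      HasDerivAt (fun t => (softThr (m + z) t - m) ^ 2 * gaussPDF z)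
        (2 * (softThr (m + z) t - m) * d * gaussPDF z) t := fun hd =>
    (((hd.sub_const m).pow 2).mul_const (gaussPDF z)).congr_deriv (by push_cast; ring)
  rcases lt_or_gt_of_ne h0 with h | h
  · have e : (fun t => softThr (m + z) t) = fun t => -max (-(m + z) - t) 0 := by
      funext t; unfold softThr; rw [Real.sign_of_neg h, abs_of_neg h]; ring
    have n1 : z ∉ Ioi (max t 0 - m) := by
      intro hz; have : max t 0 - m < z := hz; have := le_max_right t 0; linarith
    rw [indicator_of_notMem n1, zero_add]
    rcases lt_or_gt_of_ne h2 with h3 | h3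
    · have hz : z ∈ Iio (-(max t 0 + m)) := by
        change z < _
        rcases max_cases t 0 with ⟨h4, h5⟩ | ⟨h4, h5⟩ <;> rw [h4] <;> linarith
      rw [indicator_of_mem hz]
      have hd : HasDerivAt (fun t => softThr (m + z) t) 1 t := by
        rw [e]
        have : HasDerivAt (fun t => t + (m + z)) 1 t := (hasDerivAt_id t).add_const _
        refine this.congr_of_eventuallyEq ?_
        filter_upwards [eventually_lt_nhds (show t < -(m + z) by linarith)] with s hs
        rw [max_eq_left (by linarith)]; ring
      refine (hs hd).congr_deriv ?_
      have : softThr (m + z) t = t + (m + z) := by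
        rw [congrFun e t, max_eq_left (by linarith)]; ring
      rw [this]; ring
    · have hz : z ∉ Iio (-(max t 0 + m)) := by
        intro hz; have : z < -(max t 0 + m) := hz; have := le_max_left t 0; linarith
      rw [indicator_of_notMem hz]
      have hd : HasDerivAt (fun t => softThr (m + z) t) 0 t := by
        rw [e]
        refine (hasDerivAt_const t (0:ℝ)).congr_of_eventuallyEq ?_
        filter_upwards [eventually_gt_nhds (show -(m + z) < t by linarith)] with s hs
        rw [max_eq_right (by linarith)]; ring
      exact (hs hd).congr_deriv (by ring)
  · have e : (fun t => softThr (m + z) t) = fun t => max ((m + z) - t) 0 := by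
      funext t; unfold softThr; rw [Real.sign_of_pos h, abs_of_pos h]; ring
    have n1 : z ∉ Iio (-(max t 0 + m)) := by
      intro hz; have : z < -(max t 0 + m) := hz; have := le_max_right t 0; linarith
    rw [indicator_of_notMem n1, add_zero]
    rcases lt_or_gt_of_ne h1 with h3 | h3
    · have hz : z ∉ Ioi (max t 0 - m) := by
        intro hz; have : max t 0 - m < z := hz; have := le_max_left t 0; linarith
      rw [indicator_of_notMem hz]
      have hd : HasDerivAt (fun t => softThr (m + z) t) 0 t := by
        rw [e]
        refine (hasDerivAt_const t (0:ℝ)).congr_of_eventuallyEq ?_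
        filter_upwards [eventually_gt_nhds (show (m + z) < t by linarith)] with s hs
        rw [max_eq_right (by linarith)]
      exact (hs hd).congr_deriv (by ring)
    · have hz : z ∈ Ioi (max t 0 - m) := by
        change _ < z
        rcases max_cases t 0 with ⟨h4, h5⟩ | ⟨h4, h5⟩ <;> rw [h4] <;> linarith
      rw [indicator_of_mem hz]
      have hd : HasDerivAt (fun t => softThr (m + z) t) (-1) t := by
        rw [e]
        have : HasDerivAt (fun t => (m + z) - t) (-1) t := (hasDerivAt_id t).const_sub _
        refine this.congr_of_eventuallyEq ?_
        filter_upwards [eventually_lt_nhds (show t < (m + z) by linarith)] with s hs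
        rw [max_eq_left (by linarith)]
      refine (hs hd).congr_deriv ?_
      have : softThr (m + z) t = (m + z) - t := by
        rw [congrFun e t, max_eq_left (by linarith)]
      rw [this]; ring

noncomputable def dd (t m : ℝ) : ℝ :=
  2 * t * (Q (max t 0 - m) + Q (max t 0 + m))
    - 2 * (gaussPDF (max t 0 - m) + gaussPDF (max t 0 + m))

lemma dd_eq {t : ℝ} (ht : 0 ≤ t) (m : ℝ) : dd t m = 2 * A m t := by
  unfold dd A; rw [max_eq_left ht]; ring

lemma dd_bound (t m : ℝ) : |dd t m| ≤ 4 * |t| + 4 := by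
  unfold dd
  have := Q_nonneg (max t 0 - m)
  have := Q_nonneg (max t 0 + m)
  have := Q_le_one (max t 0 - m)
  have := Q_le_one (max t 0 + m)
  have := phi_pos (max t 0 - m)
  have := phi_pos (max t 0 + m)
  have := phi_le_one (max t 0 - m)
  have := phi_le_one (max t 0 + m)
  refine (abs_sub _ _).trans ?_
  rw [abs_mul, abs_mul, abs_of_pos (show (0:ℝ) < 2 by norm_num)]
  rw [abs_of_nonneg (show 0 ≤ Q (max t 0 - m) + Q (max t 0 + m) by linarith),
    abs_of_nonneg (show 0 ≤ 2 * (gaussPDF (max t 0 - m) + gaussPDF (max t 0 + m)) by linarith)]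
  have : 2 * |t| * (Q (max t 0 - m) + Q (max t 0 + m)) ≤ 2 * |t| * 2 := by
    gcongr; linarith
  linarith

lemma integrand'_integral (t m : ℝ) : ∫ z, integrand' t m z = dd t m := by
  unfold integrand'
  have i1 : Integrable (fun z => -2 * (z * gaussPDF z) + 2 * t * gaussPDF z) :=
    (phi_int1.const_mul _).add (phi_int.const_mul _)
  have i2 : Integrable (fun z => 2 * (z * gaussPDF z) + 2 * t * gaussPDF z) :=
    (phi_int1.const_mul _).add (phi_int.const_mul _)
  rw [integral_add (i1.indicator measurableSet_Ioi) (i2.indicator measurableSet_Iio),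
    integral_indicator measurableSet_Ioi, integral_indicator measurableSet_Iio,
    integral_add (phi_int1.const_mul _).integrableOn (phi_int.const_mul _).integrableOn,
    integral_add (phi_int1.const_mul _).integrableOn (phi_int.const_mul _).integrableOn,
    integral_const_mul, integral_const_mul, integral_const_mul, integral_const_mul,
    phi_m1, phi_m1_lower, Q_lower]
  change _ + 2 * t * Q (max t 0 - m) + _ = _
  unfold dd; ring

lemma integrand'_meas (t m : ℝ) : Measurable (integrand' t m) := by
  unfold integrand'
  have := phi_cont.measurable
  exact (Measurable.indicator (by fun_prop) measurableSet_Ioi).add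
    (Measurable.indicator (by fun_prop) measurableSet_Iio)

lemma inner_deriv (t m : ℝ) : HasDerivAt (fun t => ∫ z, integrand t m z) (dd t m) t := by
  rw [← integrand'_integral]
  have hbi : Integrable (fun z : ℝ => 2 * (|z| + |t| + 1) * gaussPDF z) := by
    have h := ((phi_int1.abs).const_mul 2).add (phi_int.const_mul (2 * (|t| + 1)))
    refine h.congr (Eventually.of_forall fun z => ?_)
    simp only [Pi.add_apply, abs_mul, abs_of_pos (phi_pos z)]; ring
  refine (hasDerivAt_integral_of_dominated_loc_of_lip (F := fun t z => integrand t m z)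
    (bound := fun z => 2 * (|z| + |t| + 1) * gaussPDF z)
    (Metric.ball_mem_nhds t one_pos)
    (Eventually.of_forall fun s => (integrand_meas' s m).aestronglyMeasurable)
    (integrand_int t m) (integrand'_meas t m).aestronglyMeasurable
    (Eventually.of_forall fun z => ?_) hbi ?_).2
  · apply LipschitzOnWith.of_dist_le_mul
    intro x hx y hy
    have hp := phi_pos z
    rw [Real.coe_nnabs, Real.dist_eq, Real.dist_eq,
      abs_of_nonneg (show 0 ≤ 2 * (|z| + |t| + 1) * gaussPDF z by positivity)]
    have hb : ∀ s ∈ Metric.ball t 1, |softThr (m + z) s - m| ≤ |z| + |t| + 1 := by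
      intro s hs
      have h := soft_bound (m + z) s m
      rw [add_sub_cancel_left] at h
      rw [Metric.mem_ball, Real.dist_eq] at hs
      have := abs_sub_abs_le_abs_sub s t
      linarith
    have e : integrand x m z - integrand y m z =
      ((softThr (m + z) x - m) + (softThr (m + z) y - m)) *
        (softThr (m + z) x - softThr (m + z) y) * gaussPDF z := by unfold integrand; ring
    rw [e, abs_mul, abs_mul, abs_of_pos hp]
    have h1 := abs_add_le (softThr (m + z) x - m) (softThr (m + z) y - m)
    have h2 : |softThr (m + z) x - m + (softThr (m + z) y - m)| ≤ 2 * (|z| + |t| + 1) := by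
      linarith [hb x hx, hb y hy]
    have h3 := soft_lip (m + z) x y
    calc _ ≤ (2 * (|z| + |t| + 1)) * |x - y| * gaussPDF z := by gcongr
      _ = _ := by ring
  · have hf : ({-m, t - m, -t - m} : Set ℝ).Finite := by simp
    have := hf.measure_zero volume
    filter_upwards [compl_mem_ae_iff.2 this] with z hz
    simp only [mem_compl_iff, mem_insert_iff, mem_singleton_iff, not_or] at hz
    apply integrand_deriv
    · intro h; apply hz.1; linarith
    · intro h; apply hz.2.1; linarith
    · intro h; apply hz.2.2; linarith

lemma dd_meas (t : ℝ) : Measurable (dd t) := by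
  unfold dd
  have := phi_cont.measurable
  have := Q_cont.measurable
  fun_prop

lemma inner_meas (t : ℝ) : StronglyMeasurable (fun m => ∫ z, integrand t m z) :=
  (integrand_meas t).stronglyMeasurable.integral_prod_right

lemma inner_int (G : Measure ℝ) [IsProbabilityMeasure G] (t : ℝ) :
    Integrable (fun m => ∫ z, integrand t m z) G := by
  refine Integrable.of_bound (inner_meas t).aestronglyMeasurable
    (∫ z, (2 * (z ^ 2 * gaussPDF z) + 2 * t ^ 2 * gaussPDF z)) (Eventually.of_forall fun m => ?_)
  rw [Real.norm_eq_abs, abs_of_nonneg (integral_nonneg fun z => integrand_nonneg t m z)]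
  exact integral_mono (integrand_int t m) (bound_int t) fun z => integrand_bound t m z

lemma risk_deriv (G : Measure ℝ) [IsProbabilityMeasure G] (t : ℝ) :
    HasDerivAt (stRisk G) (∫ m, dd t m ∂G) t := by
  refine (hasDerivAt_integral_of_dominated_loc_of_deriv_le (μ := G)
    (F := fun t m => ∫ z, integrand t m z) (F' := dd)
    (bound := fun _ => 4 * (|t| + 1) + 4) (Metric.ball_mem_nhds t one_pos)
    (Eventually.of_forall fun s => (inner_meas s).aestronglyMeasurable)
    (inner_int G t) (dd_meas t).aestronglyMeasurable
    (Eventually.of_forall fun m s hs => ?_) (integrable_const _)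
    (Eventually.of_forall fun m s hs => inner_deriv s m)).2
  rw [Metric.mem_ball, Real.dist_eq] at hs
  have := abs_sub_abs_le_abs_sub s t
  have := dd_bound s m
  rw [Real.norm_eq_abs]
  linarith

lemma A_bound {t : ℝ} (ht : 0 ≤ t) (m : ℝ) : |A m t| ≤ 2 * t + 2 := by
  have := dd_bound t m
  rw [dd_eq ht, abs_mul, abs_of_pos (show (0:ℝ) < 2 by norm_num), abs_of_nonneg ht] at this
  linarith

section
variable (G : Measure ℝ) [IsProbabilityMeasure G]

lemma A_int {t : ℝ} (ht : 0 ≤ t) : Integrable (fun m => A m t) G :=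
  Integrable.of_bound (A_cont' t).aestronglyMeasurable (2 * t + 2)
    (Eventually.of_forall fun m => A_bound ht m)

noncomputable def D (t : ℝ) : ℝ := ∫ m, A m t ∂G

lemma risk_deriv' {t : ℝ} (ht : 0 ≤ t) : deriv (stRisk G) t = 2 * D G t := by
  rw [(risk_deriv G t).deriv]
  simp_rw [dd_eq ht]
  rw [integral_const_mul]; rfl

lemma S_strict (hne : 0 < G {m : ℝ | m ≠ 0}) : StrictMonoOn (fun t => D G t / B t) (Ici 0) := by
  intro a ha b hb hab
  have ha : 0 ≤ a := ha
  have hb : 0 ≤ b := hb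
  have ia := (A_int G ha).div_const (B a)
  have ib := (A_int G hb).div_const (B b)
  have : 0 < ∫ m, (A m b / B b - A m a / B a) ∂G := by
    have iab : Integrable (fun m => A m b / B b - A m a / B a) G := ib.sub ia
    rw [integral_pos_iff_support_of_nonneg_ae _ iab]
    · refine hne.trans_le (measure_mono fun m hm => ?_)
      exact (sub_pos.2 (R_strict hm ha hb hab)).ne'
    · exact Eventually.of_forall fun m => sub_nonneg.2 (R_mono m ha hb hab.le)
  rw [integral_sub ib ia, integral_div, integral_div] at this
  exact sub_pos.1 this

lemma D_cont (T : ℝ) : ContinuousOn (D G) (Icc 0 T) := by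
  refine continuousOn_of_dominated (bound := fun _ => 2 * T + 2)
    (fun t _ => (A_cont' t).aestronglyMeasurable)
    (fun t ht => Eventually.of_forall fun m => ?_) (integrable_const _)
    (Eventually.of_forall fun m => (A_cont m).continuousOn)
  exact (A_bound ht.1 m).trans (by linarith [ht.2])

lemma D_zero : D G 0 < 0 := by
  have h : ∀ m, A m 0 = -(2 * gaussPDF m) := fun m => by
    unfold A; rw [zero_sub, zero_add, phi_even]; ring
  unfold D
  have hi := A_int G le_rfl
  simp_rw [h] at hi ⊢
  rw [integral_neg, neg_lt_zero, integral_pos_iff_support_of_nonneg]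
  · have : Function.support (fun m => 2 * gaussPDF m) = univ := by
      ext m; simp [(phi_pos m).ne']
    rw [this]; simp
  · intro m; exact (mul_pos two_pos (phi_pos m)).le
  · simpa using hi.neg

lemma D_pos (hne : 0 < G {m : ℝ | m ≠ 0}) : ∃ t, 0 ≤ t ∧ 0 < D G t := by
  obtain ⟨n, hn⟩ : ∃ n : ℕ, 0 < G {m : ℝ | 1 / ((n : ℝ) + 1) ≤ |m|} := by
    by_contra! hcon
    have : G (⋃ n : ℕ, {m : ℝ | 1 / ((n : ℝ) + 1) ≤ |m|}) = 0 :=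
      measure_iUnion_null fun n => nonpos_iff_eq_zero.1 (hcon n)
    refine hne.ne' (measure_mono_null (fun m hm => ?_) this)
    obtain ⟨n, hn⟩ := exists_nat_one_div_lt (abs_pos.2 hm)
    exact mem_iUnion.2 ⟨n, hn.le⟩
  set e : ℝ := 1 / ((n : ℝ) + 1) with he
  have he0 : 0 < e := by positivity
  set E : Set ℝ := {m : ℝ | e ≤ |m|} with hE
  have hEm : MeasurableSet E := measurableSet_le measurable_const measurable_id.abs
  set c : ℝ := G.real E with hc
  have hc0 : 0 < c := ENNReal.toReal_pos hn.ne' (measure_ne_top _ _)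
  -- lower bound
  have key : ∀ t, 0 ≤ t → 
      gaussPDF t * (c * (e / 2 * (e / 2 * Real.exp (t * (e / 2) - e ^ 2 / 2))) - 2 * c - 2) ≤ D G t := by
    intro t ht
    have hlow : ∀ m, E.indicator (fun _ => A e t) m - 2 * B t ≤ A m t := by
      intro m
      by_cases hm : m ∈ E
      · rw [indicator_of_mem hm, ← A_abs m]
        have : A e t ≤ A |m| t := A_mono he0.le hm
        linarith [B_pos t]
      · rw [indicator_of_notMem hm, ← A_abs m]
        have : A 0 t ≤ A |m| t := A_mono le_rfl (abs_nonneg m)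
        rw [A_zero] at this; linarith
    have i1 : Integrable (E.indicator (fun _ => A e t)) G := (integrable_const _).indicator hEm
    have := integral_mono (i1.sub (integrable_const (2 * B t))) (A_int G ht) hlow
    have e2 : ∫ m, (E.indicator (fun _ => A e t) m - 2 * B t) ∂G = c * A e t - 2 * B t := by
      rw [integral_sub i1 (integrable_const _), integral_indicator_const _ hEm, integral_const]
      simp [hc]
    change ∫ m, (E.indicator (fun _ => A e t) m - 2 * B t) ∂G ≤ _ at this
    rw [e2] at this
    have hB : B t ≤ gaussPDF t := by
      unfold B; have := mul_nonneg ht (Q_nonneg t); linarith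
    have h3 := mul_le_mul_of_nonneg_left (A_lower he0 ht) hc0.le
    unfold D
    linarith
  have hex : ∃ t, 0 ≤ t ∧ 0 < c * (e / 2 * (e / 2 * Real.exp (t * (e / 2) - e ^ 2 / 2))) - 2 * c - 2 := by
    have h1 : Tendsto (fun t : ℝ => t * (e / 2) - e ^ 2 / 2) atTop atTop :=
      tendsto_atTop_add_const_right _ _ (tendsto_id.atTop_mul_const (by positivity))
    have h2 := Real.tendsto_exp_atTop.comp h1
    have h3 := h2.const_mul_atTop (show 0 < c * (e / 2 * (e / 2)) by positivity)
    obtain ⟨t, ht, ht0⟩ := ((h3.eventually_gt_atTop (2 * c + 2)).and (eventually_ge_atTop 0)).exists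
    refine ⟨t, ht0, ?_⟩
    simp only [Function.comp] at ht
    linarith
  obtain ⟨t, ht, hp⟩ := hex
  exact ⟨t, ht, (mul_pos (phi_pos t) hp).trans_le (key t ht)⟩

end

end STB


/-- if `P(μ ≠ 0) > 0`, the derivative of the soft-thresholding risk has
exactly one sign change on `[0, ∞)` (negative then positive), so the risk is bowl-shaped:
it attains its global minimum over `[0, ∞)` at some `τ* > 0`, is nonincreasing on
`[0, τ*]` and nondecreasing on `[τ*, ∞)`. -/
theorem stRisk_bowl_shaped (G : Measure ℝ) [IsProbabilityMeasure G]
    (hG : Integrable (fun m => m ^ 2) G) (hne : 0 < G {m : ℝ | m ≠ 0}) :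
    ∃ τstar : ℝ, 0 < τstar ∧
      (∀ τ : ℝ, 0 ≤ τ → τ < τstar → deriv (stRisk G) τ < 0) ∧
      (∀ τ : ℝ, τstar < τ → 0 < deriv (stRisk G) τ) ∧
      (∀ τ : ℝ, 0 ≤ τ → stRisk G τstar ≤ stRisk G τ) ∧
      AntitoneOn (stRisk G) (Set.Icc 0 τstar) ∧
      MonotoneOn (stRisk G) (Set.Ici τstar) := by
  obtain ⟨T, hT, hTp⟩ := STB.D_pos G hne
  have h0 := STB.D_zero G
  obtain ⟨s, hs, hs0⟩ := intermediate_value_Icc hT (STB.D_cont G T) ⟨h0.le, hTp.le⟩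
  have hspos : 0 < s := by
    rcases hs.1.eq_or_lt with h | h
    · rw [← h] at hs0; exact absurd hs0 h0.ne
    · exact h
  have hS := STB.S_strict G hne
  have hSs : STB.D G s / STB.B s = 0 := by rw [hs0, zero_div]
  have hneg : ∀ τ : ℝ, 0 ≤ τ → τ < s → deriv (stRisk G) τ < 0 := by
    intro τ h1 h2
    have := hS (Set.mem_Ici.2 h1) (Set.mem_Ici.2 hspos.le) h2
    simp only [hSs] at this
    rw [div_neg_iff] at this
    have hB := STB.B_pos τ
    rw [STB.risk_deriv' G h1]
    rcases this with h | h <;> linarith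
  have hpos : ∀ τ : ℝ, s < τ → 0 < deriv (stRisk G) τ := by
    intro τ h2
    have h1 : 0 ≤ τ := by linarith
    have := hS (Set.mem_Ici.2 hspos.le) (Set.mem_Ici.2 h1) h2
    simp only [hSs] at this
    rw [div_pos_iff] at this
    have hB := STB.B_pos τ
    rw [STB.risk_deriv' G h1]
    rcases this with h | h <;> linarith
  have hdiff : Differentiable ℝ (stRisk G) := fun t => (STB.risk_deriv G t).differentiableAt
  have hanti : AntitoneOn (stRisk G) (Set.Icc 0 s) := by
    apply antitoneOn_of_deriv_nonpos (convex_Icc 0 s) hdiff.continuous.continuousOn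
      hdiff.differentiableOn
    intro x hx
    rw [interior_Icc] at hx
    exact (hneg x hx.1.le hx.2).le
  have hmono : MonotoneOn (stRisk G) (Set.Ici s) := by
    apply monotoneOn_of_deriv_nonneg (convex_Ici s) hdiff.continuous.continuousOn
      hdiff.differentiableOn
    intro x hx
    rw [interior_Ici] at hx
    exact (hpos x hx).le
  refine ⟨s, hspos, hneg, hpos, ?_, hanti, hmono⟩
  intro τ hτ
  rcases le_total τ s with h | h
  · exact hanti ⟨hτ, h⟩ ⟨hspos.le, le_rfl⟩ h
  · exact hmono (Set.mem_Ici.2 le_rfl) h h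
end

section
/- Assume the state-evolution fixed-point setup: σ : (0, ∞) → (0, ∞) is differentiable and satisfies σ(β)² = σ_w² + (1/δ)·E[(η(X + σ(β)Z; β·σ(β)) − X)²] for every β > 0. Define λ(β) = β·σ(β)·(1 − (1/δ)·P(|X + σ(β)Z| > β·σ(β))). Then at every β > 0 at which λ(β) > 0, the derivative satisfies dλ/dβ > 0; in particular λ is strictly increasing on any interval where it is positive. -/
open MeasureTheory

open Filter Topology Set

namespace LS

lemma pdf_eq : gaussPDF = ProbabilityTheory.gaussianPDFReal 0 1 := by
  funext z
  simp only [gaussPDF, ProbabilityTheory.gaussianPDFReal]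
  simp
  rw [div_eq_mul_inv, mul_comm]
  simp

lemma pdf_int : Integrable gaussPDF := by
  rw [pdf_eq]; exact ProbabilityTheory.integrable_gaussianPDFReal 0 1

lemma pdf_one : ∫ z, gaussPDF z = 1 := by
  rw [pdf_eq]; exact ProbabilityTheory.integral_gaussianPDFReal_eq_one 0 one_ne_zero

lemma pdf_pos (z : ℝ) : 0 < gaussPDF z := by
  unfold gaussPDF; positivity

lemma pdf_neg (z : ℝ) : gaussPDF (-z) = gaussPDF z := by
  simp [gaussPDF]

lemma sqrt_ge : (1 : ℝ) ≤ Real.sqrt (2 * Real.pi) := by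
  rw [Real.one_le_sqrt]; nlinarith [Real.pi_gt_three]

lemma pdf_le_exp (z : ℝ) : gaussPDF z ≤ Real.exp (-z ^ 2 / 2) := by
  unfold gaussPDF
  exact div_le_self (Real.exp_pos _).le sqrt_ge

lemma pdf_le (z : ℝ) : gaussPDF z ≤ 1 := by
  refine (pdf_le_exp z).trans ?_
  rw [Real.exp_le_one_iff]; nlinarith [sq_nonneg z]

lemma pdf_anti {y z : ℝ} (h : y ^ 2 ≤ z ^ 2) : gaussPDF z ≤ gaussPDF y := by
  unfold gaussPDF
  gcongr

lemma pdf_deriv (z : ℝ) : HasDerivAt gaussPDF (-z * gaussPDF z) z := by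
  have h : HasDerivAt (fun z : ℝ => -z ^ 2 / 2) (-z) z := by
    have := ((hasDerivAt_pow 2 z).neg).div_const 2
    refine this.congr_deriv ?_
    norm_num; ring
  have := (h.exp).div_const (Real.sqrt (2 * Real.pi))
  refine this.congr_deriv ?_
  unfold gaussPDF; ring

lemma pdf_cont : Continuous gaussPDF := by
  unfold gaussPDF; fun_prop

lemma pdf_tendsto : Tendsto (fun z => z * gaussPDF z) atTop (𝓝 0) := by
  have h := Real.tendsto_pow_mul_exp_neg_atTop_nhds_zero 1
  refine tendsto_of_tendsto_of_tendsto_of_le_of_le' tendsto_const_nhds h ?_ ?_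
  · filter_upwards [eventually_ge_atTop 2] with z hz
    have := pdf_pos z
    positivity
  · filter_upwards [eventually_ge_atTop 2] with z hz
    rw [pow_one]
    have : gaussPDF z ≤ Real.exp (-z) := (pdf_le_exp z).trans (Real.exp_le_exp.2 (by nlinarith))
    gcongr

lemma pdf_tendsto0 : Tendsto gaussPDF atTop (𝓝 0) := by
  refine tendsto_of_tendsto_of_tendsto_of_le_of_le' tendsto_const_nhds pdf_tendsto ?_ ?_
  · exact Eventually.of_forall fun z => (pdf_pos z).le
  · filter_upwards [eventually_ge_atTop 1] with z hz
    nlinarith [pdf_pos z]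

/-- Gaussian tail. -/
noncomputable def Q (a : ℝ) : ℝ := ∫ z in Ioi a, gaussPDF z

lemma Q_eq (a : ℝ) : Q a = Q 0 - ∫ z in (0:ℝ)..a, gaussPDF z := by
  have := intervalIntegral.integral_Ioi_sub_Ioi' (a := 0) (b := a) (f := gaussPDF) (μ := volume)
    pdf_int.integrableOn pdf_int.integrableOn
  unfold Q; linarith

lemma Q_deriv (a : ℝ) : HasDerivAt Q (-gaussPDF a) a := by
  have h : Q = fun a => Q 0 - ∫ z in (0:ℝ)..a, gaussPDF z := funext Q_eq
  rw [h]
  exact (intervalIntegral.integral_hasDerivAt_right pdf_int.intervalIntegrable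
    (pdf_cont.stronglyMeasurableAtFilter _ _) pdf_cont.continuousAt).const_sub (Q 0)

lemma Q_cont : Continuous Q := continuous_iff_continuousAt.2 fun a => (Q_deriv a).continuousAt

lemma Q_tendsto : Tendsto Q atTop (𝓝 0) := by
  have h : Q = fun a => Q 0 - ∫ z in (0:ℝ)..a, gaussPDF z := funext Q_eq
  rw [h]
  have := (intervalIntegral_tendsto_integral_Ioi (μ := volume) (f := gaussPDF) 0
    pdf_int.integrableOn tendsto_id).const_sub (Q 0)
  simpa [Q] using this

lemma Q_lip (a b : ℝ) : |Q a - Q b| ≤ |a - b| := by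
  have := Convex.norm_image_sub_le_of_norm_hasDerivWithin_le (f := Q) (C := 1) (s := univ)
    (x := b) (y := a) (fun x _ => (Q_deriv x).hasDerivWithinAt) (fun x _ => by
      rw [norm_neg, Real.norm_eq_abs, abs_of_pos (pdf_pos x)]; exact pdf_le x) convex_univ
      (mem_univ _) (mem_univ _)
  simpa using this

lemma Q_nonneg (a : ℝ) : 0 ≤ Q a := integral_nonneg fun z => (pdf_pos z).le

lemma Q_left (b : ℝ) : ∫ z in Iio (-b), gaussPDF z = Q b := by
  rw [← integral_Iic_eq_integral_Iio, Q, ← integral_comp_neg_Ioi]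
  simp [pdf_neg]

lemma sq_tail (β a : ℝ) : IntegrableOn (fun z => (z - β) ^ 2 * gaussPDF z) (Ioi a) ∧
    ∫ z in Ioi a, (z - β) ^ 2 * gaussPDF z = (a - 2 * β) * gaussPDF a + (1 + β ^ 2) * Q a := by
  have hd : ∀ z ∈ Ici a, HasDerivAt (fun z => -((z - 2 * β) * gaussPDF z) - (1 + β ^ 2) * Q z)
      ((z - β) ^ 2 * gaussPDF z) z := by
    intro z _
    have := ((((hasDerivAt_id z).sub_const (2 * β)).mul (pdf_deriv z)).neg).sub
      ((Q_deriv z).const_mul (1 + β ^ 2))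
    refine this.congr_deriv ?_
    simp only [id]; ring
  have ht : Tendsto (fun z => -((z - 2 * β) * gaussPDF z) - (1 + β ^ 2) * Q z) atTop (𝓝 0) := by
    have := ((pdf_tendsto.sub (pdf_tendsto0.const_mul (2 * β))).neg).sub
      (Q_tendsto.const_mul (1 + β ^ 2))
    simp only [mul_zero, sub_zero, neg_zero] at this
    refine this.congr fun z => ?_
    ring
  have hp : ∀ z ∈ Ioi a, 0 ≤ (z - β) ^ 2 * gaussPDF z := fun z _ =>
    mul_nonneg (sq_nonneg _) (pdf_pos z).le
  refine ⟨integrableOn_Ioi_deriv_of_nonneg' hd hp ht, ?_⟩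
  rw [integral_Ioi_of_hasDerivAt_of_nonneg' hd hp ht]
  ring

lemma sq_tail_left (β b : ℝ) : IntegrableOn (fun z => (z + β) ^ 2 * gaussPDF z) (Iio (-b)) ∧
    ∫ z in Iio (-b), (z + β) ^ 2 * gaussPDF z
      = (b - 2 * β) * gaussPDF b + (1 + β ^ 2) * Q b := by
  have h := sq_tail β b
  have e : (fun z => (z - β) ^ 2 * gaussPDF z) = fun z => (fun z => (z + β) ^ 2 * gaussPDF z) (-z) := by
    funext z; simp only [pdf_neg]; ring
  constructor
  · have := h.1
    rw [e] at this
    rw [← neg_neg b] at this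
    have h2 := this.comp_neg_Iio
    simpa using h2
  · rw [← integral_Iic_eq_integral_Iio, ← integral_comp_neg_Ioi, ← e]
    exact h.2

noncomputable def p (β m : ℝ) : ℝ := Q (β - m) + Q (β + m)
noncomputable def f (β m : ℝ) : ℝ := gaussPDF (β - m) + gaussPDF (β + m)
noncomputable def d (β m : ℝ) : ℝ := m * (gaussPDF (β - m) - gaussPDF (β + m))
noncomputable def r (β m : ℝ) : ℝ :=
  (1 + β ^ 2) * p β m - β * f β m - d β m + m ^ 2 * (1 - p β m)

lemma set_eq {β σ : ℝ} (hσ : 0 < σ) (m : ℝ) :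
    {z : ℝ | β * σ < |σ * m + σ * z|} = Iio (-(β + m)) ∪ Ioi (β - m) := by
  ext z
  have : |σ * m + σ * z| = |m + z| * σ := by
    rw [← mul_add, abs_mul, abs_of_pos hσ, mul_comm]
  change β * σ < |σ * m + σ * z| ↔ _
  rw [this, mul_lt_mul_iff_left₀ hσ, lt_abs]
  simp only [mem_union, mem_Iio, mem_Ioi]
  constructor
  · rintro (h | h)
    · right; linarith
    · left; linarith
  · rintro (h | h)
    · right; linarith
    · left; linarith

lemma inner_P' {β σ : ℝ} (hβ : 0 < β) (hσ : 0 < σ) (m : ℝ) :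
    ∫ z in {z : ℝ | β * σ < |σ * m + σ * z|}, gaussPDF z = p β m := by
  rw [set_eq hσ, setIntegral_union _ measurableSet_Ioi pdf_int.integrableOn pdf_int.integrableOn,
    Q_left, p, Q, Q, add_comm]
  rw [Set.disjoint_left]
  intro z h1 h2
  simp only [mem_Iio, mem_Ioi] at h1 h2
  linarith

lemma soft_hi {β σ y : ℝ} (hβ : 0 < β) (hσ : 0 < σ) (h : β < y) :
    softThr (σ * y) (β * σ) = σ * (y - β) := by
  have h0 : 0 < σ * y := mul_pos hσ (hβ.trans h)
  rw [softThr, Real.sign_of_pos h0, abs_of_pos h0, max_eq_left (by nlinarith)]; ring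

lemma soft_lo {β σ y : ℝ} (hβ : 0 < β) (hσ : 0 < σ) (h : y < -β) :
    softThr (σ * y) (β * σ) = σ * (y + β) := by
  have h0 : σ * y < 0 := mul_neg_of_pos_of_neg hσ (by linarith)
  rw [softThr, Real.sign_of_neg h0, abs_of_neg h0, max_eq_left (by nlinarith)]; ring

lemma soft_mid {β σ y : ℝ} (hσ : 0 < σ) (h1 : -β ≤ y) (h2 : y ≤ β) :
    softThr (σ * y) (β * σ) = 0 := by
  rw [softThr, max_eq_right, mul_zero]
  rw [abs_mul, abs_of_pos hσ]
  have := abs_le.2 ⟨h1, h2⟩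
  nlinarith

lemma inner_R' {β σ : ℝ} (hβ : 0 < β) (hσ : 0 < σ) (m : ℝ) :
    ∫ z, (softThr (σ * m + σ * z) (β * σ) - σ * m) ^ 2 * gaussPDF z = σ ^ 2 * r β m := by
  have e : (fun z => (softThr (σ * m + σ * z) (β * σ) - σ * m) ^ 2 * gaussPDF z) = fun z =>
      σ ^ 2 * (m ^ 2 * gaussPDF z + ((Ioi (β - m)).indicator (fun z => (z - β) ^ 2 * gaussPDF z - m ^ 2 * gaussPDF z) z
        + (Iio (-(β + m))).indicator (fun z => (z + β) ^ 2 * gaussPDF z - m ^ 2 * gaussPDF z) z)) := by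
    funext z
    rw [← mul_add]
    rcases lt_or_ge β (m + z) with h | h
    · rw [soft_hi hβ hσ h, indicator_of_mem (by simp only [mem_Ioi]; linarith),
        indicator_of_notMem (by simp only [mem_Iio]; linarith)]
      ring
    · rcases lt_or_ge (m + z) (-β) with h' | h'
      · rw [soft_lo hβ hσ h', indicator_of_notMem (by simp only [mem_Ioi]; linarith),
          indicator_of_mem (by simp only [mem_Iio]; linarith)]
        ring
      · rw [soft_mid hσ h' h, indicator_of_notMem (by simp only [mem_Ioi]; linarith),
          indicator_of_notMem (by simp only [mem_Iio]; linarith)]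
        ring
  have i0 : Integrable (fun z => m ^ 2 * gaussPDF z) := pdf_int.const_mul _
  obtain ⟨i1, v1⟩ := sq_tail β (β - m)
  obtain ⟨i2, v2⟩ := sq_tail_left β (β + m)
  have j1 : IntegrableOn (fun z => (z - β) ^ 2 * gaussPDF z - m ^ 2 * gaussPDF z) (Ioi (β - m)) :=
    i1.sub i0.integrableOn
  have j2 : IntegrableOn (fun z => (z + β) ^ 2 * gaussPDF z - m ^ 2 * gaussPDF z)
    (Iio (-(β + m))) := i2.sub i0.integrableOn
  have k1 := j1.integrable_indicator measurableSet_Ioi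
  have k2 := j2.integrable_indicator measurableSet_Iio
  have k12 : Integrable (fun z => (Ioi (β - m)).indicator (fun z => (z - β) ^ 2 * gaussPDF z - m ^ 2 * gaussPDF z) z
        + (Iio (-(β + m))).indicator (fun z => (z + β) ^ 2 * gaussPDF z - m ^ 2 * gaussPDF z) z) :=
    k1.add k2
  rw [e, integral_const_mul, integral_add i0 k12, integral_add k1 k2,
    integral_indicator measurableSet_Ioi, integral_indicator measurableSet_Iio,
    integral_sub i1 i0.integrableOn, integral_sub i2 i0.integrableOn, v1, v2,
    integral_const_mul, integral_const_mul, integral_const_mul, pdf_one, Q_left,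
    show ∫ z in Ioi (β - m), gaussPDF z = Q (β - m) from rfl]
  simp only [r, p, f, d]
  ring

lemma inner_P {β σ : ℝ} (hβ : 0 < β) (hσ : 0 < σ) (x : ℝ) :
    ∫ z in {z : ℝ | β * σ < |x + σ * z|}, gaussPDF z = p β (x * σ⁻¹) := by
  rw [← inner_P' hβ hσ, mul_comm x, mul_inv_cancel_left₀ hσ.ne']

lemma inner_R {β σ : ℝ} (hβ : 0 < β) (hσ : 0 < σ) (x : ℝ) :
    ∫ z, (softThr (x + σ * z) (β * σ) - x) ^ 2 * gaussPDF z = σ ^ 2 * r β (x * σ⁻¹) := by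
  rw [← inner_R' hβ hσ, mul_comm x, mul_inv_cancel_left₀ hσ.ne']

lemma p_nonneg (β m : ℝ) : 0 ≤ p β m := add_nonneg (Q_nonneg _) (Q_nonneg _)

lemma p_le {β : ℝ} (hβ : 0 < β) (m : ℝ) : p β m ≤ 1 := by
  rw [← inner_P' hβ one_pos, ← pdf_one]
  exact setIntegral_le_integral pdf_int (Eventually.of_forall fun z => (pdf_pos z).le)

lemma f_nonneg (β m : ℝ) : 0 ≤ f β m := (add_pos (pdf_pos _) (pdf_pos _)).le
lemma f_le (β m : ℝ) : f β m ≤ 2 := by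
  have := pdf_le (β - m); have := pdf_le (β + m); unfold f; linarith

lemma d_nonneg {β : ℝ} (hβ : 0 < β) (m : ℝ) : 0 ≤ d β m := by
  unfold d
  rcases le_total 0 m with h | h
  · exact mul_nonneg h (sub_nonneg.2 (pdf_anti (by nlinarith)))
  · exact mul_nonneg_of_nonpos_of_nonpos h (sub_nonpos.2 (pdf_anti (by nlinarith)))

lemma d_le (β m : ℝ) : |d β m| ≤ |m| := by
  unfold d
  rw [abs_mul]
  refine mul_le_of_le_one_right (abs_nonneg _) (abs_le.2 ⟨?_, ?_⟩) <;>
  linarith [pdf_pos (β - m), pdf_pos (β + m), pdf_le (β - m), pdf_le (β + m)]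

lemma p_cont (β : ℝ) : Continuous (p β) := by
  have := Q_cont; unfold p; fun_prop
lemma f_cont (β : ℝ) : Continuous (f β) := by
  have := pdf_cont; unfold f; fun_prop
lemma d_cont (β : ℝ) : Continuous (d β) := by
  have := pdf_cont; unfold d; fun_prop
lemma r_cont (β : ℝ) : Continuous (r β) := by
  have := p_cont β; have := f_cont β; have := d_cont β; unfold r; fun_prop

lemma p_deriv {B M : ℝ → ℝ} {B' M' s : ℝ} (hB : HasDerivAt B B' s) (hM : HasDerivAt M M' s) :
    HasDerivAt (fun s => p (B s) (M s))
      (-f (B s) (M s) * B' + (gaussPDF (B s - M s) - gaussPDF (B s + M s)) * M') s := by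
  have h1 := (Q_deriv (B s - M s)).comp s (hB.sub hM)
  have h2 := (Q_deriv (B s + M s)).comp s (hB.add hM)
  refine (h1.add h2).congr_deriv ?_
  unfold f; ring

lemma r_deriv {B M : ℝ → ℝ} {B' M' s : ℝ} (hB : HasDerivAt B B' s) (hM : HasDerivAt M M' s) :
    HasDerivAt (fun s => r (B s) (M s))
      ((2 * B s * p (B s) (M s) - 2 * f (B s) (M s)) * B'
        + 2 * M s * (1 - p (B s) (M s)) * M') s := by
  have hp := p_deriv hB hM
  have h1 := (pdf_deriv (B s - M s)).comp s (hB.sub hM)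
  have h2 := (pdf_deriv (B s + M s)).comp s (hB.add hM)
  have h := (((((hB.pow 2).const_add 1).mul hp).sub (hB.mul (h1.add h2))).sub
    (hM.mul (h1.sub h2))).add ((hM.pow 2).mul (hp.const_sub 1))
  refine h.congr_deriv ?_
  simp only [Pi.add_apply, Pi.sub_apply, Pi.pow_apply, Function.comp, f]
  norm_num
  ring

lemma p_lip (β β' m m' : ℝ) : |p β m - p β' m'| ≤ 2 * (|β - β'| + |m - m'|) := by
  have h1 := Q_lip (β - m) (β' - m')
  have h2 := Q_lip (β + m) (β' + m')
  have h3 : |β - m - (β' - m')| ≤ |β - β'| + |m - m'| := by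
    rw [show β - m - (β' - m') = (β - β') - (m - m') by ring]; exact abs_sub _ _
  have h4 : |β + m - (β' + m')| ≤ |β - β'| + |m - m'| := by
    rw [show β + m - (β' + m') = (β - β') + (m - m') by ring]; exact abs_add_le _ _
  have h5 : |p β m - p β' m'| ≤ |Q (β - m) - Q (β' - m')| + |Q (β + m) - Q (β' + m')| := by
    unfold p
    rw [show ∀ a b c d : ℝ, a + b - (c + d) = (a - c) + (b - d) by intros; ring]
    exact abs_add_le _ _
  linarith

lemma r_lip_b {β β' C : ℝ} (hβ : 0 < β) (hβ' : 0 < β') (h : β ≤ C) (h' : β' ≤ C) (m : ℝ) :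
    |r β m - r β' m| ≤ (2 * C + 4) * |β - β'| := by
  refine Convex.norm_image_sub_le_of_norm_hasDerivWithin_le (f := fun s => r s m) (s := Ioc 0 C)
    (x := β') (y := β) (fun x _ => (r_deriv (hasDerivAt_id x)
      (hasDerivAt_const x m)).hasDerivWithinAt) ?_ (convex_Ioc _ _) ⟨hβ', h'⟩ ⟨hβ, h⟩
  rintro x ⟨h1, h2⟩
  simp only [id, mul_one, mul_zero, add_zero, Real.norm_eq_abs]
  have := p_nonneg x m; have := p_le h1 m; have := f_nonneg x m; have := f_le x m
  rw [abs_le]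
  constructor <;> nlinarith

lemma r_lip_m {β m m' C : ℝ} (hβ : 0 < β) (h : |m| ≤ C) (h' : |m'| ≤ C) :
    |r β m - r β m'| ≤ (2 * C) * |m - m'| := by
  refine Convex.norm_image_sub_le_of_norm_hasDerivWithin_le (f := fun s => r β s) (s := Icc (-C) C)
    (x := m') (y := m) (fun x _ => (r_deriv (hasDerivAt_const x β)
      (hasDerivAt_id x)).hasDerivWithinAt) ?_ (convex_Icc _ _) (abs_le.1 h') (abs_le.1 h)
  rintro x hx
  have hx := abs_le.2 hx
  simp only [id, mul_one, mul_zero, zero_add, Real.norm_eq_abs]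
  have := p_nonneg β x; have := p_le hβ x
  rw [abs_mul, abs_mul, abs_two, abs_of_nonneg (a := 1 - p β x) (by linarith)]
  nlinarith [abs_nonneg x]

lemma gen {G : Measure ℝ} {F : ℝ → ℝ → ℝ} {F' bound : ℝ → ℝ} {s : Set ℝ} {x₀ : ℝ}
    (hs : s ∈ 𝓝 x₀) (hF : ∀ x, Continuous (F x)) (hF_int : Integrable (F x₀) G)
    (hF' : Continuous F') (hl : ∀ a, ∀ x ∈ s, |F x a - F x₀ a| ≤ bound a * |x - x₀|)
    (hb : Integrable bound G) (hd : ∀ a, HasDerivAt (F · a) (F' a) x₀) :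
    HasDerivAt (fun x => ∫ a, F x a ∂G) (∫ a, F' a ∂G) x₀ := by
  set L : ℝ →L[ℝ] ℝ →L[ℝ] ℝ := ContinuousLinearMap.smulRightL ℝ ℝ ℝ 1
  have h_diff : ∀ a, HasFDerivAt (F · a) (L (F' a)) x₀ := fun a => (hd a).hasFDerivAt
  have hm : AEStronglyMeasurable (L ∘ F') G :=
    L.continuous.comp_aestronglyMeasurable hF'.aestronglyMeasurable
  obtain ⟨hi, key⟩ := hasFDerivAt_integral_of_dominated_loc_of_lip' (bound := bound)
    hs (fun x _ => (hF x).aestronglyMeasurable) hF_int hm (Eventually.of_forall hl) hb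
    (Eventually.of_forall h_diff)
  have hF'_int : Integrable F' G := by
    rw [← integrable_norm_iff hm] at hi
    rw [← integrable_norm_iff hF'.aestronglyMeasurable]
    simpa [L, (· ∘ ·)] using! hi
  simp_rw [hasDerivAt_iff_hasFDerivAt]
  simpa only [(· ∘ ·), ContinuousLinearMap.integral_comp_comm _ hF'_int] using! key

section
variable {G : Measure ℝ} [IsProbabilityMeasure G] (hX : Integrable (fun x => x ^ 2) G)
include hX

lemma int_abs : Integrable (fun x : ℝ => |x|) G := by
  refine (hX.add (integrable_const (1:ℝ))).mono' continuous_abs.aestronglyMeasurable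
    (Eventually.of_forall fun x => ?_)
  simp only [Real.norm_eq_abs, abs_abs, Pi.add_apply]
  nlinarith [sq_abs x, sq_nonneg (|x| - 1), abs_nonneg x]

omit hX in
lemma int_p {β : ℝ} (hβ : 0 < β) (t : ℝ) : Integrable (fun x => p β (x * t)) G := by
  refine (integrable_const (1:ℝ)).mono'
    ((p_cont β).comp (by fun_prop : Continuous fun x : ℝ => x * t)).aestronglyMeasurable
    (Eventually.of_forall fun x => ?_)
  rw [Real.norm_eq_abs, abs_of_nonneg (p_nonneg _ _)]; exact p_le hβ _

omit hX in
lemma int_f (β : ℝ) (t : ℝ) : Integrable (fun x => f β (x * t)) G := by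
  refine (integrable_const (2:ℝ)).mono'
    ((f_cont β).comp (by fun_prop : Continuous fun x : ℝ => x * t)).aestronglyMeasurable
    (Eventually.of_forall fun x => ?_)
  rw [Real.norm_eq_abs, abs_of_nonneg (f_nonneg _ _)]; exact f_le _ _

lemma int_d (β : ℝ) (t : ℝ) : Integrable (fun x => d β (x * t)) G := by
  refine ((int_abs hX).mul_const |t|).mono'
    ((d_cont β).comp (by fun_prop : Continuous fun x : ℝ => x * t)).aestronglyMeasurable
    (Eventually.of_forall fun x => ?_)
  rw [Real.norm_eq_abs, ← abs_mul]; exact d_le _ _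

lemma int_u {β : ℝ} (hβ : 0 < β) (t : ℝ) :
    Integrable (fun x => (x * t) ^ 2 * (1 - p β (x * t))) G := by
  have := p_cont β
  refine (hX.mul_const (t ^ 2)).mono'
    (by fun_prop : Continuous fun x : ℝ => (x * t) ^ 2 * (1 - p β (x * t))).aestronglyMeasurable
    (Eventually.of_forall fun x => ?_)
  have h1 := p_nonneg β (x * t); have h2 := p_le hβ (x * t)
  rw [Real.norm_eq_abs, abs_of_nonneg (mul_nonneg (sq_nonneg _) (by linarith)), ← mul_pow]
  nlinarith [sq_nonneg (x * t)]

lemma r_int_eq {β : ℝ} (hβ : 0 < β) (t : ℝ) : Integrable (fun x => r β (x * t)) G ∧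
    ∫ x, r β (x * t) ∂G = (1 + β ^ 2) * ∫ x, p β (x * t) ∂G - β * ∫ x, f β (x * t) ∂G
      - ∫ x, d β (x * t) ∂G + ∫ x, (x * t) ^ 2 * (1 - p β (x * t)) ∂G := by
  have i1 : Integrable (fun x => (1 + β ^ 2) * p β (x * t)) G := (int_p hβ t).const_mul _
  have i2 : Integrable (fun x => β * f β (x * t)) G := (int_f β t).const_mul _
  have i3 := int_d hX β t
  have i4 := int_u hX hβ t
  have i12 : Integrable (fun x => (1 + β ^ 2) * p β (x * t) - β * f β (x * t)) G := i1.sub i2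
  have i123 : Integrable
    (fun x => (1 + β ^ 2) * p β (x * t) - β * f β (x * t) - d β (x * t)) G := i12.sub i3
  refine ⟨i123.add i4, ?_⟩
  unfold r
  rw [integral_add i123 i4, integral_sub i12 i3, integral_sub i1 i2, integral_const_mul,
    integral_const_mul]

omit hX [IsProbabilityMeasure G] in
lemma nbhd {t : ℝ → ℝ} {t' β : ℝ} (hβ : 0 < β) (ht : HasDerivAt t t' β) :
    ∃ C ≥ 0, ∃ s ∈ 𝓝 β, ∀ b ∈ s, 0 < b ∧ b ≤ β + 1 ∧ |t b - t β| ≤ C * |b - β| ∧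
      |t b| ≤ |t β| + C := by
  obtain ⟨C, hC, h⟩ := ht.isBigO_sub.exists_nonneg
  rw [Asymptotics.isBigOWith_iff] at h
  refine ⟨C, hC, _, inter_mem h (inter_mem (Ioi_mem_nhds hβ)
    (Metric.closedBall_mem_nhds β one_pos)), ?_⟩
  rintro b ⟨h1, h2, h3⟩
  have h1 : |t b - t β| ≤ C * |b - β| := h1
  rw [Metric.mem_closedBall, Real.dist_eq] at h3
  refine ⟨h2, by linarith [(abs_le.1 h3).2], h1, ?_⟩
  have h4 : |t b| ≤ |t β| + |t b - t β| := by
    have := abs_add_le (t β) (t b - t β)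
    rwa [add_sub_cancel] at this
  nlinarith [abs_nonneg (b - β)]

lemma P_deriv {t : ℝ → ℝ} {s β : ℝ} (hβ : 0 < β) (ht : HasDerivAt t (-(s * t β)) β) :
    HasDerivAt (fun b => ∫ x, p b (x * t b) ∂G)
      (-(∫ x, f β (x * t β) ∂G) - s * ∫ x, d β (x * t β) ∂G) β := by
  obtain ⟨C, hC, S, hS, h⟩ := nbhd hβ ht
  have key := gen (G := G) (F := fun b x => p b (x * t b))
    (F' := fun x => -f β (x * t β) - s * d β (x * t β)) (bound := fun x => 2 * (1 + |x| * C)) hS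
    (fun b => (p_cont b).comp (by fun_prop)) (int_p hβ _)
    (by have := f_cont β; have := d_cont β; fun_prop) ?_ ?_ ?_
  · refine key.congr_deriv ?_
    have i1 : Integrable (fun x => -f β (x * t β)) G := (int_f β _).neg
    have i2 : Integrable (fun x => s * d β (x * t β)) G := (int_d hX β _).const_mul _
    rw [integral_sub i1 i2, integral_neg, integral_const_mul]
  · intro x b hb
    obtain ⟨-, -, h1, -⟩ := h b hb
    refine (p_lip _ _ _ _).trans ?_
    rw [← mul_sub, abs_mul]
    nlinarith [mul_le_mul_of_nonneg_left h1 (abs_nonneg x)]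
  · exact ((integrable_const 1).add ((int_abs hX).mul_const C)).const_mul 2
  · intro x
    refine (p_deriv (hasDerivAt_id β) (ht.const_mul x)).congr_deriv ?_
    simp only [id, d]; ring

lemma R_deriv {t : ℝ → ℝ} {s β : ℝ} (hβ : 0 < β) (ht : HasDerivAt t (-(s * t β)) β) :
    HasDerivAt (fun b => ∫ x, r b (x * t b) ∂G)
      (2 * β * (∫ x, p β (x * t β) ∂G) - 2 * (∫ x, f β (x * t β) ∂G)
        - 2 * s * ∫ x, (x * t β) ^ 2 * (1 - p β (x * t β)) ∂G) β := by
  obtain ⟨C, hC, S, hS, h⟩ := nbhd hβ ht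
  have key := gen (G := G) (F := fun b x => r b (x * t b))
    (F' := fun x => 2 * β * p β (x * t β) - 2 * f β (x * t β)
      - 2 * s * ((x * t β) ^ 2 * (1 - p β (x * t β))))
    (bound := fun x => (2 * (β + 1) + 4) + x ^ 2 * (2 * (|t β| + C) * C)) hS
    (fun b => (r_cont b).comp (by fun_prop)) (r_int_eq hX hβ _).1
    (by have := f_cont β; have := p_cont β; fun_prop) ?_ ?_ ?_
  · refine key.congr_deriv ?_
    have i1 : Integrable (fun x => 2 * β * p β (x * t β)) G := (int_p hβ _).const_mul _
    have i2 : Integrable (fun x => 2 * f β (x * t β)) G := (int_f β _).const_mul _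
    have i3 : Integrable (fun x => 2 * s * ((x * t β) ^ 2 * (1 - p β (x * t β)))) G :=
      (int_u hX hβ _).const_mul _
    have i12 : Integrable (fun x => 2 * β * p β (x * t β) - 2 * f β (x * t β)) G := i1.sub i2
    rw [integral_sub i12 i3, integral_sub i1 i2, integral_const_mul, integral_const_mul,
      integral_const_mul]
  · intro x b hb
    obtain ⟨h0, h1, h2, h3⟩ := h b hb
    have e1 := r_lip_b h0 hβ h1 (by linarith) (x * t b)
    have a1 : |x * t b| ≤ |x| * (|t β| + C) := by rw [abs_mul]; gcongr
    have a2 : |x * t β| ≤ |x| * (|t β| + C) := by rw [abs_mul]; gcongr; linarith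
    have e2 := r_lip_m hβ a1 a2
    rw [← mul_sub, abs_mul] at e2
    have e3 : 2 * (|x| * (|t β| + C)) * (|x| * |t b - t β|) ≤
        2 * (|x| * (|t β| + C)) * (|x| * (C * |b - β|)) := by gcongr
    have e4 : 2 * (|x| * (|t β| + C)) * (|x| * (C * |b - β|)) =
        x ^ 2 * (2 * (|t β| + C) * C) * |b - β| := by rw [← sq_abs x]; ring
    have e5 := abs_sub_le (r b (x * t b)) (r β (x * t b)) (r β (x * t β))
    linarith
  · exact (integrable_const _).add (hX.mul_const _)
  · intro x
    refine (r_deriv (hasDerivAt_id β) (ht.const_mul x)).congr_deriv ?_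
    simp only [id]; ring

end

lemma alg {δ β P Φ D U w s : ℝ} (hβ : 0 < β) (hΦ : 0 ≤ Φ) (hP : 0 ≤ P)
    (hD : 0 ≤ D) (hU : 0 ≤ U) (hw : 0 < w) (hpos : 0 < δ - P)
    (h1 : δ - ((1 + β ^ 2) * P - β * Φ - D + U) = w)
    (h2 : s * (δ - ((1 + β ^ 2) * P - β * Φ - D)) = β * P - Φ) :
    0 < (δ - P) * (1 + β * s) + β * (Φ + s * D) := by
  set K := δ - ((1 + β ^ 2) * P - β * Φ - D) with hK
  have hKpos : 0 < K := by linarith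
  have key : 0 < ((δ - P) * (1 + β * s) + β * (Φ + s * D)) * K := by
    have e : ((δ - P) * (1 + β * s) + β * (Φ + s * D)) * K =
        (δ - P) * (K + β * (s * K)) + β * (Φ * K + (s * K) * D) := by ring
    rw [e, h2]
    have e2 : K + β * (β * P - Φ) = δ - P + D := by rw [hK]; ring
    rw [e2]
    have t1 : 0 < (δ - P) * (δ - P + D) := by positivity
    rcases le_total Φ (β * P) with h | h
    · have : 0 ≤ (β * P - Φ) * D := mul_nonneg (by linarith) hD
      positivity
    · have e3 : Φ * K + (β * P - Φ) * D = Φ * (δ - P) + β * (Φ * (Φ - β * P)) + β * P * D := by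
        rw [hK]; ring
      rw [e3]
      have : 0 ≤ Φ - β * P := by linarith
      positivity
  exact pos_of_mul_pos_left key hKpos.le

end LS

theorem lambda_strictMono (G : Measure ℝ) [IsProbabilityMeasure G]
    (hX : Integrable (fun x => x ^ 2) G)
    (δ σw : ℝ) (hδ : 0 < δ) (hδ1 : δ ≤ 1) (hσw : 0 < σw)
    (σ : ℝ → ℝ) (hσpos : ∀ β : ℝ, 0 < β → 0 < σ β)
    (hσdiff : ∀ β : ℝ, 0 < β → DifferentiableAt ℝ σ β)
    (hfix : ∀ β : ℝ, 0 < β →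
      (σ β) ^ 2 = σw ^ 2 +
        (1 / δ) * ∫ x, (∫ z, (softThr (x + σ β * z) (β * σ β) - x) ^ 2 * gaussPDF z) ∂G)
    (lam : ℝ → ℝ)
    (hlam : ∀ β : ℝ, lam β = β * σ β *
      (1 - (1 / δ) * ∫ x, (∫ z in {z : ℝ | β * σ β < |x + σ β * z|}, gaussPDF z) ∂G)) :
    (∀ β : ℝ, 0 < β → 0 < lam β → 0 < deriv lam β) ∧
    ∀ β₁ β₂ : ℝ, 0 < β₁ → β₁ < β₂ →
      (∀ β ∈ Set.Icc β₁ β₂, 0 < lam β) → lam β₁ < lam β₂ := by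
  have hlam' : ∀ β, 0 < β → lam β = β * σ β *
      (1 - (1 / δ) * ∫ x, LS.p β (x * (σ β)⁻¹) ∂G) := by
    intro β hβ
    rw [hlam]; simp_rw [LS.inner_P hβ (hσpos β hβ)]
  have hfix' : ∀ β, 0 < β → (σ β) ^ 2 = σw ^ 2 +
      (1 / δ) * ((σ β) ^ 2 * ∫ x, LS.r β (x * (σ β)⁻¹) ∂G) := by
    intro β hβ
    have := hfix β hβ
    simp_rw [LS.inner_R hβ (hσpos β hβ)] at this
    rwa [integral_const_mul] at this
  have main : ∀ β : ℝ, 0 < β → 0 < lam β → 0 < deriv lam β := by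
    intro β hβ hl
    have hσ := hσpos β hβ
    have hd := (hσdiff β hβ).hasDerivAt
    set s := deriv σ β / σ β with hs
    have hds : deriv σ β = s * σ β := by rw [hs]; field_simp
    rw [hds] at hd
    have ht : HasDerivAt (fun b => (σ b)⁻¹) (-(s * (σ β)⁻¹)) β := by
      refine (hd.fun_inv hσ.ne').congr_deriv ?_
      field_simp
    have hP := LS.P_deriv hX hβ ht
    have hR := LS.R_deriv hX hβ ht
    have hr := (LS.r_int_eq hX hβ (σ β)⁻¹).2
    have hfb := hfix' β hβ
    have hlb := hlam' β hβ
    have nP : 0 ≤ ∫ x, LS.p β (x * (σ β)⁻¹) ∂G := integral_nonneg fun x => LS.p_nonneg _ _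
    have nF : 0 ≤ ∫ x, LS.f β (x * (σ β)⁻¹) ∂G := integral_nonneg fun x => LS.f_nonneg _ _
    have nD : 0 ≤ ∫ x, LS.d β (x * (σ β)⁻¹) ∂G := integral_nonneg fun x => LS.d_nonneg hβ _
    have nU : 0 ≤ ∫ x, (x * (σ β)⁻¹) ^ 2 * (1 - LS.p β (x * (σ β)⁻¹)) ∂G :=
      integral_nonneg fun x => mul_nonneg (sq_nonneg _) (sub_nonneg.2 (LS.p_le hβ _))
    have hLd := ((hasDerivAt_id β).mul hd).mul ((hP.const_mul (1 / δ)).const_sub 1)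
    have hev : lam =ᶠ[𝓝 β] fun b => b * σ b *
      (1 - (1 / δ) * ∫ x, LS.p b (x * (σ b)⁻¹) ∂G) := by
      filter_upwards [Ioi_mem_nhds hβ] with b hb using hlam' b hb
    have hLd' := (HasDerivAt.congr_of_eventuallyEq hLd hev).deriv
    have hS1 := hd.pow 2
    have hS2 := (((hd.pow 2).mul hR).const_mul (1 / δ)).const_add (σw ^ 2)
    have hev2 : (fun b => σ b ^ 2) =ᶠ[𝓝 β] fun b => σw ^ 2 +
      (1 / δ) * ((σ b) ^ 2 * ∫ x, LS.r b (x * (σ b)⁻¹) ∂G) := by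
      filter_upwards [Ioi_mem_nhds hβ] with b hb using hfix' b hb
    have hEq := hS1.unique (HasDerivAt.congr_of_eventuallyEq hS2 hev2)
    rw [hLd']
    simp only [Pi.mul_apply, Pi.pow_apply, id] at hEq ⊢
    rw [hr] at hfb hEq
    generalize (∫ x, LS.p β (x * (σ β)⁻¹) ∂G) = P at *
    generalize (∫ x, LS.f β (x * (σ β)⁻¹) ∂G) = Φ at *
    generalize (∫ x, LS.d β (x * (σ β)⁻¹) ∂G) = D at *
    generalize (∫ x, (x * (σ β)⁻¹) ^ 2 * (1 - LS.p β (x * (σ β)⁻¹)) ∂G) = U at *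
    generalize σ β = S at *
    have hpos : 0 < δ - P := by
      rw [hlb] at hl
      have := pos_of_mul_pos_right hl (by positivity)
      have h3 := mul_pos hδ this
      have : δ * (1 - 1 / δ * P) = δ - P := by field_simp
      linarith
    have h1 : δ - ((1 + β ^ 2) * P - β * Φ - D + U) = δ * σw ^ 2 / S ^ 2 := by
      field_simp at hfb ⊢
      linarith
    have h2 : s * (δ - ((1 + β ^ 2) * P - β * Φ - D)) = β * P - Φ := by
      have hS2 : S ^ 2 ≠ 0 := by positivity
      norm_num at hEq
      field_simp at hEq
      linarith
    have := LS.alg hβ nF nP nD nU (by positivity) hpos h1 h2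
    have e : (1 * S + β * (s * S)) * (1 - 1 / δ * P) + β * S * -(1 / δ * (-Φ - s * D)) =
      S / δ * ((δ - P) * (1 + β * s) + β * (Φ + s * D)) := by
      field_simp; ring
    rw [e]
    positivity
  refine ⟨main, fun β₁ β₂ h1 h12 hpos => ?_⟩
  have hm : StrictMonoOn lam (Icc β₁ β₂) := by
    refine strictMonoOn_of_deriv_pos (convex_Icc _ _) ?_ ?_
    · intro b hb
      have : deriv lam b ≠ 0 := (main b (h1.trans_le hb.1) (hpos b hb)).ne'
      exact (differentiableAt_of_deriv_ne_zero this).continuousAt.continuousWithinAt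
    · intro b hb
      have hb := interior_subset hb
      exact main b (h1.trans_le hb.1) (hpos b hb)
  exact hm (left_mem_Icc.2 h12.le) (right_mem_Icc.2 h12.le) h12
end
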